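/- Let d ≥ 3. There exist constants c > 0 and c' > 0 depending only on d such that for every integer L_0 ≥ c', every n ≥ 0, every ℓ ≥ 2, and all finite paths w_1, …, w_ℓ ∈ 𝒯, one has Σ_{x} e_V(x)·P_x[ R_ℓ < ∞ and (X_{R_k + j})_{0 ≤ j ≤ D_k − R_k} = w_k for each 1 ≤ k ≤ ℓ ] ≤ (c·L_{n+1}^{−(d−2)})^{ℓ−1} · Π_{k=1}^{ℓ} ( Σ_x e_V(x)·P_x[ (X_j)_{0 ≤ j ≤ T_U} = w_k ] ). -/

import Mathlib

open MeasureTheory Filter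

namespace RI

/-- Points of `ℤ^d`. -/
abbrev Zd (d : ℕ) := Fin d → ℤ

/-- `x` and `y` are nearest neighbours: `|x - y| = 1`. -/
def adj {d : ℕ} (x y : Zd d) : Prop := (∑ i, |x i - y i|) = 1

/-- `x` and `y` are `*`-neighbours: `|x - y|_∞ = 1`. -/
def starAdj {d : ℕ} (x y : Zd d) : Prop := x ≠ y ∧ ∀ i, |x i - y i| ≤ 1

/-- `x` belongs to the plane `ℤ e₁ + ℤ e₂ ⊆ ℤ^d`. -/
def inPlane {d : ℕ} (x : Zd d) : Prop := ∀ i : Fin d, 2 ≤ (i : ℕ) → x i = 0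

/-- The `k`-th coordinate of `x`, with value `0` for out-of-range indices. -/
def coord {d : ℕ} (x : Zd d) (k : ℕ) : ℤ := if h : k < d then x ⟨k, h⟩ else 0

/-- `P` is the family of laws of the simple random walks on `ℤ^d` started at the points of
`ℤ^d`: each `P x` is a probability measure on the path space `ℕ → ℤ^d`, and the cylinder
probabilities are those of the walk with i.i.d. increments uniform on `{± e_i}`. -/
def IsSRW (d : ℕ) (P : Zd d → Measure (ℕ → Zd d)) : Prop :=
  (∀ x, IsProbabilityMeasure (P x)) ∧
  (∀ (x : Zd d) (n : ℕ) (w : ℕ → Zd d),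
      (w 0 = x ∧ ∀ k < n, adj (w k) (w (k + 1))) →
        P x {ω | ∀ k ≤ n, ω k = w k} = ((2 * d : ENNReal))⁻¹ ^ n) ∧
  (∀ (x : Zd d) (n : ℕ) (w : ℕ → Zd d),
      ¬(w 0 = x ∧ ∀ k < n, adj (w k) (w (k + 1))) →
        P x {ω | ∀ k ≤ n, ω k = w k} = 0)

/-- The equilibrium measure of a set `V ⊆ ℤ^d`:
`e_V(x) = P_x[H̃_V = ∞]` for `x ∈ V`, and `0` otherwise. -/
noncomputable def eqm {d : ℕ} (P : Zd d → Measure (ℕ → Zd d)) (V : Set (Zd d)) : Zd d → ℝ :=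
  V.indicator fun x => (P x {ω | ∀ n, 1 ≤ n → ω n ∉ V}).toReal

/-- The capacity of a finite set `K ⊆ ℤ^d`. -/
noncomputable def capa {d : ℕ} (P : Zd d → Measure (ℕ → Zd d)) (K : Finset (Zd d)) : ℝ :=
  ∑ x ∈ K, eqm P (↑K) x

/-- `Q` is a vacant-set law at level `u`: a probability measure on `{0,1}^{ℤ^d}`
(with `true = 1` standing for "vacant") such that
`Q[Y_x = 1 ∀ x ∈ K] = exp(-u cap K)` for every finite `K`. -/
def IsVacantLaw {d : ℕ} (P : Zd d → Measure (ℕ → Zd d)) (u : ℝ)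
    (Q : Measure (Zd d → Bool)) : Prop :=
  IsProbabilityMeasure Q ∧
  ∀ K : Finset (Zd d),
    Q {Y | ∀ x ∈ K, Y x = true} = ENNReal.ofReal (Real.exp (-(u * capa P K)))

/-- There is a `*`-path starting in `S`, ending in `T`, all of whose points lie in `A`. -/
def HasStarPath {d : ℕ} (S T A : Set (Zd d)) : Prop :=
  ∃ (N : ℕ) (w : ℕ → Zd d), w 0 ∈ S ∧ w N ∈ T ∧ (∀ k ≤ N, w k ∈ A) ∧
    ∀ k < N, starAdj (w k) (w (k + 1))

/-- Interior boundary `∂_int U`. -/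
def intBdry {d : ℕ} (U : Set (Zd d)) : Set (Zd d) := {x | x ∈ U ∧ ∃ y, y ∉ U ∧ adj x y}

/-- (Exterior) boundary `∂U`. -/
def bdry {d : ℕ} (U : Set (Zd d)) : Set (Zd d) := {x | x ∉ U ∧ ∃ y ∈ U, adj x y}

/-- `ℓ = 100 ⌊L^{1/100}⌋ + 1`. -/
noncomputable def ellOf (L : ℕ) : ℕ := 100 * ⌊(L : ℝ) ^ ((1 : ℝ) / 100)⌋₊ + 1

/-- The scales `L_{n+1} = ℓ_n L_n`. -/
noncomputable def Lseq (L0 : ℕ) : ℕ → ℕ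
  | 0 => L0
  | n + 1 => ellOf (Lseq L0 n) * Lseq L0 n

/-- The levels `u_{n+1} = (1 + 1/log L_n)⁻¹ u_n`. -/
noncomputable def useq (L0 : ℕ) (u0 : ℝ) : ℕ → ℝ
  | 0 => u0
  | n + 1 => (1 + 1 / Real.log (Lseq L0 n))⁻¹ * useq L0 u0 n

/-- The event (on the configuration space `{0,1}^{ℤ^d}`) that there is a `*`-path from
`[-L,L]² ∩ ℤ²` to `∂_int ([-3L,3L]^d ∩ ℤ^d)` all of whose points lie in `{x ∈ ℤ² : Y_x = 0}`. -/
def qEvent (d : ℕ) (L : ℕ) : Set (Zd d → Bool) :=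
  {Y | HasStarPath
    {x : Zd d | inPlane x ∧ ∀ i, |x i| ≤ (L : ℤ)}
    (intBdry {x : Zd d | ∀ i, |x i| ≤ (3 * L : ℤ)})
    {x : Zd d | inPlane x ∧ Y x = false}}

/-- The embedding of `ℤ²` into `ℤ^d`. -/
def embPlane (d : ℕ) (i : ℤ × ℤ) : Zd d :=
  fun j => if (j : ℕ) = 0 then i.1 else if (j : ℕ) = 1 then i.2 else 0

/-- `V = (([-3Lₙ,3Lₙ]^d + 2Lₙ i₁) ∪ ([-3Lₙ,3Lₙ]^d + 2Lₙ i₂)) ∩ ℤ^d`. -/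
def twoBoxV (d : ℕ) (Ln : ℕ) (i1 i2 : ℤ × ℤ) : Set (Zd d) :=
  {x | ∀ j, |x j - 2 * (Ln : ℤ) * embPlane d i1 j| ≤ 3 * (Ln : ℤ)} ∪
  {x | ∀ j, |x j - 2 * (Ln : ℤ) * embPlane d i2 j| ≤ 3 * (Ln : ℤ)}

/-- `U = {z : d(z,V) ≤ L_{n+1}/10}`, the `ℓ^∞`-neighbourhood of `V` of size `L_{n+1}/10`. -/
def nbhdU (d : ℕ) (L1 : ℕ) (V : Set (Zd d)) : Set (Zd d) :=
  {z | ∃ v ∈ V, ∀ j, 10 * |z j - v j| ≤ (L1 : ℤ)}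

/-- The Finset version of `twoBoxV`. -/
noncomputable def twoBoxVF (d : ℕ) (Ln : ℕ) (i1 i2 : ℤ × ℤ) : Finset (Zd d) :=
  (Fintype.piFinset fun j => Finset.Icc (2 * (Ln : ℤ) * embPlane d i1 j - 3 * (Ln : ℤ))
      (2 * (Ln : ℤ) * embPlane d i1 j + 3 * (Ln : ℤ))) ∪
  (Fintype.piFinset fun j => Finset.Icc (2 * (Ln : ℤ) * embPlane d i2 j - 3 * (Ln : ℤ))
      (2 * (Ln : ℤ) * embPlane d i2 j + 3 * (Ln : ℤ)))

/-- First time `≥ t` at which the path is in `A` (`∞` if there is none or if `t = ∞`). -/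
noncomputable def nextIn {d : ℕ} (A : Set (Zd d)) (ω : ℕ → Zd d) (t : ℕ∞) : ℕ∞ :=
  ⨅ (m : ℕ) (_ : t ≤ (m : ℕ∞) ∧ ω m ∈ A), (m : ℕ∞)

/-- First time `≥ t` at which the path is outside `A` (`∞` if there is none or `t = ∞`). -/
noncomputable def nextOut {d : ℕ} (A : Set (Zd d)) (ω : ℕ → Zd d) (t : ℕ∞) : ℕ∞ :=
  ⨅ (m : ℕ) (_ : t ≤ (m : ℕ∞) ∧ ω m ∉ A), (m : ℕ∞)

/-- The successive return times to `V` and departure times from `U`: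
`(RD V U ω k).1 = R_k` and `(RD V U ω k).2 = D_k` for `k ≥ 1`
(with the convention `R_0 = D_0 = 0`). -/
noncomputable def RD {d : ℕ} (V U : Set (Zd d)) (ω : ℕ → Zd d) : ℕ → ℕ∞ × ℕ∞
  | 0 => (0, 0)
  | k + 1 =>
      let r := nextIn V ω (RD V U ω k).2
      (r, nextOut U ω r)

/-- `w` (of length `N`) belongs to the collection `𝒯` of paths started in `V`,
staying in `U` and ending on `∂U`. -/
def inT {d : ℕ} (V U : Set (Zd d)) (N : ℕ) (w : ℕ → Zd d) : Prop :=
  w 0 ∈ V ∧ w N ∈ bdry U ∧ (∀ i < N, w i ∈ U) ∧ ∀ i < N, adj (w i) (w (i + 1))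

/-- A function with nonnegative second derivative near `0` which vanishes to first order at `0`
is nonnegative. -/
lemma nonneg_of_hasDerivAt2_nonneg {f f' f'' : ℝ → ℝ} {b : ℝ} (hb : 0 < b)
    (hf : ∀ u ∈ Set.Icc (-b) b, HasDerivAt f (f' u) u)
    (hf' : ∀ u ∈ Set.Icc (-b) b, HasDerivAt f' (f'' u) u)
    (hf'' : ∀ u ∈ Set.Icc (-b) b, 0 ≤ f'' u) (h0 : f 0 = 0) (h0' : f' 0 = 0)
    {u : ℝ} (hu : u ∈ Set.Icc (-b) b) : 0 ≤ f u := by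
  have hsub : interior (Set.Icc (-b) b) ⊆ Set.Icc (-b) b := interior_subset
  have hconv : ConvexOn ℝ (Set.Icc (-b) b) f :=
    convexOn_of_hasDerivWithinAt2_nonneg (convex_Icc _ _)
      (fun x hx => (hf x hx).continuousAt.continuousWithinAt)
      (fun x hx => (hf x (hsub hx)).hasDerivWithinAt)
      (fun x hx => (hf' x (hsub hx)).hasDerivWithinAt) (fun x hx => hf'' x (hsub hx))
  have hmem : (0 : ℝ) ∈ interior (Set.Icc (-b) b) := by
    rw [interior_Icc]; exact ⟨by linarith, hb⟩
  have hmin := hconv.isMinOn_of_rightDeriv_eq_zero hmem (by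
    rw [((hf 0 (hsub hmem)).hasDerivWithinAt).derivWithin (uniqueDiffWithinAt_Ioi 0), h0'])
  simpa [h0] using hmin hu

lemma hasDerivAt_one_add_rpow {u : ℝ} (hu : u ∈ Set.Icc (-(1 / 2) : ℝ) (1 / 2)) (p : ℝ) :
    HasDerivAt (fun u : ℝ => (1 + u) ^ p) (p * (1 + u) ^ (p - 1)) u := by
  have h : HasDerivAt (fun u : ℝ => 1 + u) 1 u := (hasDerivAt_id u).const_add 1
  simpa using h.rpow_const (p := p) (Or.inl (by intro h0; linarith [hu.1]))

/-- Fourth order Taylor bound for `(1 + u) ^ (-s)` on `[-1/2, 1/2]`. -/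
lemma exists_one_add_rpow_neg_le {s : ℝ} (hs : 0 < s) :
    ∃ K : ℝ, 0 < K ∧ ∀ u ∈ Set.Icc (-(1 / 2) : ℝ) (1 / 2),
      (1 + u) ^ (-s) ≤ 1 - s * u + s * (s + 1) / 2 * u ^ 2
        - s * (s + 1) * (s + 2) / 6 * u ^ 3 + K * u ^ 4 := by
  set M : ℝ := s * (s + 1) * (s + 2) * (s + 3) * (1 / 2) ^ (-s - 4) with hM
  have hMpos : 0 < M := by positivity
  refine ⟨M / 24, by positivity, fun u hu => ?_⟩
  have hpow : ∀ u ∈ Set.Icc (-(1 / 2) : ℝ) (1 / 2), ∀ p : ℝ,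
      HasDerivAt (fun u : ℝ => (1 + u) ^ p) (p * (1 + u) ^ (p - 1)) u :=
    fun u hu p => hasDerivAt_one_add_rpow hu p
  have hmon : ∀ u : ℝ, ∀ n : ℕ, HasDerivAt (fun u : ℝ => u ^ n) (n * u ^ (n - 1)) u :=
    fun u n => hasDerivAt_pow n u
  have second : ∀ u ∈ Set.Icc (-(1 / 2) : ℝ) (1 / 2),
      0 ≤ s * (s + 1) - s * (s + 1) * (s + 2) * u + M / 2 * u ^ 2
        - s * (s + 1) * (1 + u) ^ (-s - 2) := by
    intro u hu
    refine nonneg_of_hasDerivAt2_nonneg (b := 1 / 2) (by norm_num)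
      (f := fun u => s * (s + 1) - s * (s + 1) * (s + 2) * u + M / 2 * u ^ 2
        - s * (s + 1) * (1 + u) ^ (-s - 2))
      (f' := fun u => -(s * (s + 1) * (s + 2)) + M * u
        + s * (s + 1) * (s + 2) * (1 + u) ^ (-s - 3))
      (f'' := fun u => M - s * (s + 1) * (s + 2) * (s + 3) * (1 + u) ^ (-s - 4))
      ?_ ?_ ?_ ?_ ?_ hu
    · intro u hu
      have h := ((((hasDerivAt_id u).const_mul (s * (s + 1) * (s + 2))).const_sub
        (s * (s + 1))).add ((hmon u 2).const_mul (M / 2))).sub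
        ((hpow u hu (-s - 2)).const_mul (s * (s + 1)))
      refine h.congr_deriv ?_
      rw [show -s - 2 - 1 = -s - 3 by ring]
      norm_num; ring
    · intro u hu
      have h := (((hasDerivAt_id u).const_mul M).const_add (-(s * (s + 1) * (s + 2)))).add
        ((hpow u hu (-s - 3)).const_mul (s * (s + 1) * (s + 2)))
      refine h.congr_deriv ?_
      rw [show -s - 3 - 1 = -s - 4 by ring]
      ring
    · intro u hu
      have : (1 + u) ^ (-s - 4) ≤ (1 / 2 : ℝ) ^ (-s - 4) :=
        Real.rpow_le_rpow_of_nonpos (by norm_num) (by linarith [hu.1]) (by linarith)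
      have h2 : 0 ≤ s * (s + 1) * (s + 2) * (s + 3) := by positivity
      have := mul_le_mul_of_nonneg_left this h2
      simp only [hM]; linarith
    · simp
    · simp
  have := nonneg_of_hasDerivAt2_nonneg (b := 1 / 2) (by norm_num)
      (f := fun u => 1 - s * u + s * (s + 1) / 2 * u ^ 2
        - s * (s + 1) * (s + 2) / 6 * u ^ 3 + M / 24 * u ^ 4 - (1 + u) ^ (-s))
      (f' := fun u => -s + s * (s + 1) * u - s * (s + 1) * (s + 2) / 2 * u ^ 2
        + M / 6 * u ^ 3 + s * (1 + u) ^ (-s - 1))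
      (f'' := fun u => s * (s + 1) - s * (s + 1) * (s + 2) * u + M / 2 * u ^ 2
        - s * (s + 1) * (1 + u) ^ (-s - 2)) ?_ ?_ second (by simp) (by simp) hu
  · linarith
  · intro u hu
    have h := (((((hasDerivAt_id u).const_mul s).const_sub 1).add
      ((hmon u 2).const_mul (s * (s + 1) / 2))).sub
      ((hmon u 3).const_mul (s * (s + 1) * (s + 2) / 6))).add
      ((hmon u 4).const_mul (M / 24)) |>.sub (hpow u hu (-s))
    refine h.congr_deriv ?_
    norm_num; ring
  · intro u hu
    have h := ((((hasDerivAt_id u).const_mul (s * (s + 1))).const_add (-s)).sub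
      ((hmon u 2).const_mul (s * (s + 1) * (s + 2) / 2))).add
      ((hmon u 3).const_mul (M / 6)) |>.add ((hpow u hu (-s - 1)).const_mul s)
    refine h.congr_deriv ?_
    rw [show -s - 1 - 1 = -s - 2 by ring]
    norm_num; ring

/-- The contribution of one coordinate direction to the discrete Laplacian of
`(|x|^2 + a) ^ (-s)`. -/
lemma exists_rpow_neg_add_le {s : ℝ} (hs : 0 < s) :
    ∃ K : ℝ, 0 < K ∧ ∀ q y : ℝ, y ^ 2 + 6 ≤ q →
      (q + 1 + 2 * y) ^ (-s) + (q + 1 - 2 * y) ^ (-s) ≤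
        q ^ (-s) * (2 - 2 * s / q + s * (s + 1) * (1 + 4 * y ^ 2) / q ^ 2
          + K * (2 + 48 * y ^ 2 + 32 * y ^ 4) / q ^ 4) := by
  obtain ⟨K, hK, h⟩ := exists_one_add_rpow_neg_le hs
  refine ⟨K, hK, fun q y hq => ?_⟩
  have hq0 : 0 < q := by nlinarith [sq_nonneg y]
  have key : ∀ y : ℝ, y ^ 2 + 6 ≤ q → (q + 1 + 2 * y) ^ (-s) ≤ q ^ (-s) *
      (1 - s * ((1 + 2 * y) / q) + s * (s + 1) / 2 * ((1 + 2 * y) / q) ^ 2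
        - s * (s + 1) * (s + 2) / 6 * ((1 + 2 * y) / q) ^ 3 + K * ((1 + 2 * y) / q) ^ 4) := by
    intro y hq
    have hu : (1 + 2 * y) / q ∈ Set.Icc (-(1 / 2) : ℝ) (1 / 2) := by
      constructor
      · rw [le_div_iff₀ hq0]; nlinarith [sq_nonneg (y + 2)]
      · rw [div_le_iff₀ hq0]; nlinarith [sq_nonneg (y - 2)]
    have hfac : q + 1 + 2 * y = q * (1 + (1 + 2 * y) / q) := by field_simp; ring
    rw [hfac, Real.mul_rpow hq0.le (by linarith [hu.1])]
    exact mul_le_mul_of_nonneg_left (h _ hu) (by positivity)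
  have h1 := key y hq
  have h2 := key (-y) (by simpa using hq)
  rw [show q + 1 - 2 * y = q + 1 + 2 * (-y) by ring]
  refine (add_le_add h1 h2).trans ?_
  rw [← mul_add]
  refine mul_le_mul_of_nonneg_left ?_ (by positivity)
  have h3 : 0 ≤ s * (s + 1) * (s + 2) / 6 * ((2 + 24 * y ^ 2) / q ^ 3) := by positivity
  have h4 : (1 + 2 * y) / q = (1 + 2 * y) * q⁻¹ := rfl
  simp only [div_eq_mul_inv, mul_pow, ← inv_pow] at h3 ⊢
  nlinarith [h3]
/-- The squared Euclidean norm. -/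
def sqNorm {d : ℕ} (x : Zd d) : ℝ := ∑ i, (x i : ℝ) ^ 2

/-- The function `(|x|² + a)^{-(d-2)/2}`, which is superharmonic for the simple random walk on
`ℤ^d` when `a` is large. -/
noncomputable def potential (d : ℕ) (a : ℝ) (x : Zd d) : ℝ :=
  (sqNorm x + a) ^ (-(((d : ℝ) - 2) / 2))

lemma sqNorm_nonneg {d : ℕ} (x : Zd d) : 0 ≤ sqNorm x := Finset.sum_nonneg fun _ _ => sq_nonneg _

lemma sq_le_sqNorm {d : ℕ} (x : Zd d) (i : Fin d) : (x i : ℝ) ^ 2 ≤ sqNorm x :=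
  Finset.single_le_sum (f := fun i => (x i : ℝ) ^ 2) (fun _ _ => sq_nonneg _) (Finset.mem_univ i)

lemma sqNorm_add_single {d : ℕ} (x : Zd d) (i : Fin d) :
    sqNorm (x + Pi.single i 1) = sqNorm x + 1 + 2 * x i := by
  have h : ∀ j, (((x + Pi.single i 1 : Zd d) j : ℤ) : ℝ) ^ 2
      = (x j : ℝ) ^ 2 + if j = i then 1 + 2 * (x j : ℝ) else 0 := by
    intro j
    by_cases hj : j = i
    · subst hj; simp; ring
    · simp [hj]
  simp only [sqNorm, h, Finset.sum_add_distrib, Finset.sum_ite_eq', Finset.mem_univ, if_true]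
  ring

lemma sqNorm_sub_single {d : ℕ} (x : Zd d) (i : Fin d) :
    sqNorm (x - Pi.single i 1) = sqNorm x + 1 - 2 * x i := by
  have := sqNorm_add_single (x - Pi.single i 1) i
  simp only [sub_add_cancel, Pi.sub_apply, Pi.single_eq_same] at this
  push_cast at this
  linarith

lemma exists_potential_superharmonic {d : ℕ} (hd : 3 ≤ d) :
    ∃ a : ℝ, 0 < a ∧ ∀ x : Zd d,
      ∑ i, (potential d a (x + Pi.single i 1) + potential d a (x - Pi.single i 1))
        ≤ 2 * d * potential d a x := by
  have hd' : (3 : ℝ) ≤ d := by exact_mod_cast hd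
  set s : ℝ := ((d : ℝ) - 2) / 2 with hs
  have hs0 : 0 < s := by rw [hs]; linarith
  obtain ⟨K, hK, h⟩ := exists_rpow_neg_add_le hs0
  set a : ℝ := 6 + (s * (s + 1) * d + K * (2 * d + 80)) / (2 * s * d) with ha
  have ha6 : 6 ≤ a := le_add_of_nonneg_right (by positivity)
  have haK : s * (s + 1) * d + K * (2 * d + 80) ≤ 2 * s * d * a := by
    rw [← div_le_iff₀' (by positivity)]
    exact le_add_of_nonneg_left (by norm_num)
  refine ⟨a, by linarith, fun x => ?_⟩
  set q : ℝ := sqNorm x + a with hq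
  have hr := sqNorm_nonneg x
  have hq0 : 0 < q := by linarith
  have step : ∀ i, potential d a (x + Pi.single i 1) + potential d a (x - Pi.single i 1) ≤
      q ^ (-s) * (2 - 2 * s / q + s * (s + 1) * (1 + 4 * (x i : ℝ) ^ 2) / q ^ 2
          + K * (2 + 48 * (x i : ℝ) ^ 2 + 32 * (x i : ℝ) ^ 4) / q ^ 4) := by
    intro i
    have := h q (x i) (by linarith [sq_le_sqNorm x i])
    rw [potential, potential, sqNorm_add_single, sqNorm_sub_single]
    convert this using 3 <;> rw [hq] <;> ring
  refine (Finset.sum_le_sum fun i _ => step i).trans ?_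
  have h4 : ∑ i, (x i : ℝ) ^ 4 ≤ sqNorm x ^ 2 := by
    calc ∑ i, (x i : ℝ) ^ 4 ≤ ∑ i, (x i : ℝ) ^ 2 * sqNorm x :=
          Finset.sum_le_sum fun i _ => by
            nlinarith [mul_le_mul_of_nonneg_left (sq_le_sqNorm x i) (sq_nonneg (x i : ℝ))]
      _ = sqNorm x ^ 2 := by rw [← Finset.sum_mul, sq]; rfl
  have hsum : ∑ i, (2 - 2 * s / q + s * (s + 1) * (1 + 4 * (x i : ℝ) ^ 2) / q ^ 2
          + K * (2 + 48 * (x i : ℝ) ^ 2 + 32 * (x i : ℝ) ^ 4) / q ^ 4) =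
      2 * d - 2 * s * d / q + s * (s + 1) * (d + 4 * sqNorm x) / q ^ 2
        + K * (2 * d + 48 * sqNorm x + 32 * ∑ i, (x i : ℝ) ^ 4) / q ^ 4 := by
    simp only [sqNorm, Finset.sum_add_distrib, Finset.sum_sub_distrib, ← Finset.sum_div,
      ← Finset.mul_sum, Finset.sum_const, Finset.card_univ, Fintype.card_fin, nsmul_eq_mul]
    ring
  rw [← Finset.mul_sum, hsum, potential, ← hq, ← hs, mul_comm]
  refine mul_le_mul_of_nonneg_right ?_ (by positivity)
  have hr1 : sqNorm x ≤ q := by linarith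
  have hq1 : 1 ≤ q := by linarith
  have hmain : K * (2 * d + 48 * sqNorm x + 32 * ∑ i, (x i : ℝ) ^ 4) ≤
      K * (2 * d + 80) * q ^ 2 := by
    rw [mul_assoc]
    refine mul_le_mul_of_nonneg_left ?_ hK.le
    have hq2 : q ≤ q ^ 2 := by nlinarith
    have hr2 : sqNorm x ^ 2 ≤ q ^ 2 := pow_le_pow_left₀ hr hr1 2
    have hd2 : (d : ℝ) * 1 ≤ d * q ^ 2 :=
      mul_le_mul_of_nonneg_left (hq1.trans hq2) (by linarith)
    linarith
  have hds : (d : ℝ) = 2 * s + 2 := by rw [hs]; ring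
  have e1 : s * (s + 1) * (4 * sqNorm x) = 2 * s * d * sqNorm x := by rw [hds]; ring
  have : - 2 * s * d / q + s * (s + 1) * (d + 4 * sqNorm x) / q ^ 2
        + K * (2 * d + 48 * sqNorm x + 32 * ∑ i, (x i : ℝ) ^ 4) / q ^ 4 ≤
      (-(2 * s * d * a) + s * (s + 1) * d + K * (2 * d + 80)) / q ^ 2 := by
    have h5 : K * (2 * d + 48 * sqNorm x + 32 * ∑ i, (x i : ℝ) ^ 4) / q ^ 4 ≤
        K * (2 * d + 80) / q ^ 2 := by
      rw [div_le_div_iff₀ (by positivity) (by positivity)]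
      nlinarith [mul_le_mul_of_nonneg_right hmain (sq_nonneg q)]
    have h6 : - 2 * s * d / q + s * (s + 1) * (d + 4 * sqNorm x) / q ^ 2 =
        (-(2 * s * d * a) + s * (s + 1) * d) / q ^ 2 := by
      rw [mul_add, e1]
      field_simp
      rw [hq]; ring
    rw [h6, add_div (_ + _)]
    linarith
  have h7 : (-(2 * s * d * a) + s * (s + 1) * d + K * (2 * d + 80)) / q ^ 2 ≤ 0 :=
    div_nonpos_of_nonpos_of_nonneg (by linarith) (by positivity)
  have h8 : -2 * s * d / q = - (2 * s * d / q) := by ring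
  linarith

/-- The event that the path agrees with `w` up to time `n`. -/
def cyl {d : ℕ} (n : ℕ) (w : ℕ → Zd d) : Set (ℕ → Zd d) := {ω | ∀ k ≤ n, ω k = w k}

/-- The time shift by `n`. -/
def shift {d : ℕ} (n : ℕ) (ω : ℕ → Zd d) : ℕ → Zd d := fun k => ω (n + k)

/-- The set `A` of paths only depends on the path up to time `m`. -/
def DependsUpTo {d : ℕ} (m : ℕ) (A : Set (ℕ → Zd d)) : Prop :=
  ∀ ω η, (∀ k ≤ m, ω k = η k) → ω ∈ A → η ∈ A

/-- Extension of a finite path by a constant. -/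
def extend {d : ℕ} {m : ℕ} (γ : Fin (m + 1) → Zd d) : ℕ → Zd d :=
  fun k => γ ⟨min k m, by omega⟩

lemma mem_cyl {d : ℕ} {n : ℕ} {w ω : ℕ → Zd d} : ω ∈ cyl n w ↔ ∀ k ≤ n, ω k = w k := Iff.rfl

lemma measurable_eval {d : ℕ} (k : ℕ) : Measurable fun ω : ℕ → Zd d => ω k := measurable_pi_apply k

lemma measurableSet_eval {d : ℕ} (k : ℕ) (S : Set (Zd d)) :
    MeasurableSet {ω : ℕ → Zd d | ω k ∈ S} :=
  measurable_eval k (Set.to_countable S).measurableSet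

lemma measurableSet_cyl {d : ℕ} (n : ℕ) (w : ℕ → Zd d) : MeasurableSet (cyl n w) := by
  have : cyl n w = ⋂ k, ⋂ (_ : k ≤ n), {ω | ω k ∈ ({w k} : Set (Zd d))} := by
    ext ω; simp [cyl]
  rw [this]
  exact MeasurableSet.iInter fun k => MeasurableSet.iInter fun _ => measurableSet_eval k _

lemma measurable_shift {d : ℕ} (n : ℕ) : Measurable (shift n : (ℕ → Zd d) → ℕ → Zd d) :=
  measurable_pi_lambda _ fun k => measurable_eval (n + k)

lemma extend_restrict {d : ℕ} {m k : ℕ} (hk : k ≤ m) (ω : ℕ → Zd d) :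
    extend (fun i : Fin (m + 1) => ω i) k = ω k := by
  simp [extend, hk]

lemma eq_iUnion_cyl {d : ℕ} {m : ℕ} {A : Set (ℕ → Zd d)} (hA : DependsUpTo m A) :
    A = ⋃ γ : ↥{γ : Fin (m + 1) → Zd d | extend γ ∈ A}, cyl m (extend γ.1) := by
  ext ω
  rw [Set.mem_iUnion]
  constructor
  · intro hω
    exact ⟨⟨fun i => ω i, hA ω _ (fun k hk => (extend_restrict hk ω).symm) hω⟩,
      fun k hk => (extend_restrict hk ω).symm⟩
  · rintro ⟨γ, h⟩
    exact hA _ _ (fun k hk => (h k hk).symm) γ.2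

lemma DependsUpTo.measurableSet {d : ℕ} {m : ℕ} {A : Set (ℕ → Zd d)} (hA : DependsUpTo m A) :
    MeasurableSet A := by
  rw [eq_iUnion_cyl hA]
  exact MeasurableSet.iUnion fun γ => measurableSet_cyl _ _

lemma generateFrom_cyl (d : ℕ) :
    (inferInstance : MeasurableSpace (ℕ → Zd d)) =
      MeasurableSpace.generateFrom {s | ∃ n w, s = cyl n w} := by
  refine le_antisymm ?_ (MeasurableSpace.generateFrom_le ?_)
  · refine iSup_le fun k => ?_
    refine Measurable.comap_le ?_
    refine @measurable_to_countable' _ _ _ _ (MeasurableSpace.generateFrom _) _ fun a => ?_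
    have hdep : DependsUpTo k ((fun ω : ℕ → Zd d => ω k) ⁻¹' {a}) := by
      intro ω ω' h hω
      simpa [← h k le_rfl] using hω
    rw [eq_iUnion_cyl hdep]
    exact MeasurableSet.iUnion fun γ => MeasurableSpace.measurableSet_generateFrom ⟨_, _, rfl⟩
  · rintro _ ⟨n, w, rfl⟩
    exact measurableSet_cyl n w

lemma isPiSystem_cyl (d : ℕ) : IsPiSystem {s : Set (ℕ → Zd d) | ∃ n w, s = cyl n w} := by
  rintro _ ⟨n, w, rfl⟩ _ ⟨m, v, rfl⟩ ⟨ω, hw, hv⟩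
  refine ⟨max n m, ω, ?_⟩
  ext ω'
  simp only [Set.mem_inter_iff, mem_cyl]
  constructor
  · rintro ⟨h1, h2⟩ k hk
    rcases le_max_iff.1 hk with h | h
    · rw [h1 k h, hw k h]
    · rw [h2 k h, hv k h]
  · intro h
    exact ⟨fun k hk => by rw [h k (le_max_of_le_left hk), hw k hk],
      fun k hk => by rw [h k (le_max_of_le_right hk), hv k hk]⟩

lemma measure_inter_eq_tsum {d : ℕ} (μ : Measure (ℕ → Zd d)) {m : ℕ} {A S : Set (ℕ → Zd d)}
    (hA : DependsUpTo m A) (hS : MeasurableSet S) :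
    μ (A ∩ S) = ∑' γ : ↥{γ : Fin (m + 1) → Zd d | extend γ ∈ A}, μ (cyl m (extend γ.1) ∩ S) := by
  conv_lhs => rw [eq_iUnion_cyl hA, Set.iUnion_inter]
  refine measure_iUnion ?_ fun γ => (measurableSet_cyl _ _).inter hS
  intro γ γ' hne
  refine Set.disjoint_left.2 fun ω h h' => hne (Subtype.ext (funext fun i => ?_))
  have h1 := h.1 i (by omega)
  have h2 := h'.1 i (by omega)
  have hi : (⟨min (i : ℕ) m, by omega⟩ : Fin (m + 1)) = i := Fin.ext (by simp; omega)
  simp only [extend, hi] at h1 h2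
  rw [← h1, ← h2]

section Walk

variable {d : ℕ} {P : Zd d → Measure (ℕ → Zd d)}

lemma cyl_inter_shift_preimage {n m : ℕ} {w v : ℕ → Zd d} (h : v 0 = w n) :
    cyl n w ∩ shift n ⁻¹' cyl m v = cyl (n + m) fun k => if k ≤ n then w k else v (k - n) := by
  ext ω
  simp only [Set.mem_inter_iff, Set.mem_preimage, mem_cyl, shift]
  constructor
  · rintro ⟨h1, h2⟩ k hk
    split_ifs with hkn
    · exact h1 k hkn
    · rw [← h2 (k - n) (by omega)]; congr 1; omega
  · intro h3
    refine ⟨fun k hk => by simpa [hk] using h3 k (by omega), fun k hk => ?_⟩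
    rw [h3 (n + k) (by omega)]
    rcases Nat.eq_zero_or_pos k with rfl | hk0
    · simp [h]
    · rw [if_neg (by omega)]; congr 1; omega

lemma IsSRW.cyl_inter_shift_cyl (hP : IsSRW d P) (x : Zd d) (n m : ℕ) (w v : ℕ → Zd d) :
    P x (cyl n w ∩ shift n ⁻¹' cyl m v) = P x (cyl n w) * P (w n) (cyl m v) := by
  by_cases h : v 0 = w n
  · rw [cyl_inter_shift_preimage h]
    have hiff : ((if 0 ≤ n then w 0 else v (0 - n)) = x ∧ ∀ k < n + m,
        adj (if k ≤ n then w k else v (k - n))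
          (if k + 1 ≤ n then w (k + 1) else v (k + 1 - n))) ↔
        (w 0 = x ∧ ∀ k < n, adj (w k) (w (k + 1))) ∧
          (v 0 = w n ∧ ∀ k < m, adj (v k) (v (k + 1))) := by
      constructor
      · rintro ⟨h1, h2⟩
        refine ⟨⟨by simpa using h1, fun k hk => ?_⟩, h, fun k hk => ?_⟩
        · have := h2 k (by omega)
          rwa [if_pos (by omega), if_pos (by omega)] at this
        · have := h2 (n + k) (by omega)
          rw [if_neg (by omega : ¬ (n + k + 1 ≤ n)), show n + k + 1 - n = k + 1 by omega] at this
          rcases Nat.eq_zero_or_pos k with rfl | hk0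
          · simpa [h] using this
          · rwa [if_neg (by omega), show n + k - n = k by omega] at this
      · rintro ⟨⟨h1, h2⟩, -, h3⟩
        refine ⟨by simpa using h1, fun k hk => ?_⟩
        rcases lt_trichotomy k n with hkn | rfl | hkn
        · rw [if_pos (by omega), if_pos (by omega)]; exact h2 k hkn
        · rw [if_pos le_rfl, if_neg (by omega), ← h]
          simpa using h3 0 (by omega)
        · rw [if_neg (by omega), if_neg (by omega), show k + 1 - n = k - n + 1 by omega]
          exact h3 _ (by omega)
    by_cases h1 : w 0 = x ∧ ∀ k < n, adj (w k) (w (k + 1))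
    · by_cases h2 : v 0 = w n ∧ ∀ k < m, adj (v k) (v (k + 1))
      · rw [cyl, cyl, cyl, hP.2.1 x _ _ (hiff.2 ⟨h1, h2⟩), hP.2.1 _ _ _ h1, hP.2.1 _ _ _ h2,
          pow_add]
      · rw [cyl, cyl, cyl, hP.2.2 x _ _ (fun h => h2 (hiff.1 h).2), hP.2.2 _ _ _ h2, mul_zero]
    · rw [cyl, cyl, cyl, hP.2.2 x _ _ (fun h => h1 (hiff.1 h).1), hP.2.2 _ _ _ h1, zero_mul]
  · have h0 : P (w n) (cyl m v) = 0 := hP.2.2 _ _ _ fun h' => h h'.1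
    have : cyl n w ∩ shift n ⁻¹' cyl m v = ∅ := by
      refine Set.eq_empty_of_forall_notMem fun ω hω => h ?_
      have h1 := hω.1 n le_rfl
      have h2 := hω.2 0 (Nat.zero_le _)
      simp only [shift, add_zero] at h2
      rw [← h1, ← h2]
    rw [this, h0, measure_empty, mul_zero]

lemma IsSRW.cyl_inter_shift (hP : IsSRW d P) (x : Zd d) (n : ℕ) (w : ℕ → Zd d)
    {B : Set (ℕ → Zd d)} (hB : MeasurableSet B) :
    P x (cyl n w ∩ shift n ⁻¹' B) = P x (cyl n w) * P (w n) B := by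
  have := hP.1
  have heq : ((P x).restrict (cyl n w)).map (shift n) = P x (cyl n w) • P (w n) := by
    have happ : ∀ B, MeasurableSet B → ((P x).restrict (cyl n w)).map (shift n) B =
        P x (cyl n w ∩ shift n ⁻¹' B) := fun B hB => by
      rw [Measure.map_apply (measurable_shift n) hB,
        Measure.restrict_apply (measurable_shift n hB), Set.inter_comm]
    refine ext_of_generate_finite _ (generateFrom_cyl d) (isPiSystem_cyl d) ?_ ?_
    · rintro _ ⟨m, v, rfl⟩
      rw [happ _ (measurableSet_cyl m v), hP.cyl_inter_shift_cyl]
      rfl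
    · rw [happ _ MeasurableSet.univ]
      simp
  rw [Set.inter_comm, ← Measure.restrict_apply (measurable_shift n hB),
    ← Measure.map_apply (measurable_shift n) hB, heq]
  rfl

/-- The Markov property. -/
lemma IsSRW.markov (hP : IsSRW d P) (x : Zd d) {m : ℕ} {v : Zd d} {A B : Set (ℕ → Zd d)}
    (hA : DependsUpTo m A) (hv : ∀ ω ∈ A, ω m = v) (hB : MeasurableSet B) :
    P x (A ∩ shift m ⁻¹' B) = P x A * P v B := by
  have h1 := measure_inter_eq_tsum (P x) hA (measurable_shift m hB)
  have h2 := measure_inter_eq_tsum (P x) hA MeasurableSet.univ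
  simp only [Set.inter_univ] at h2
  rw [h1, h2, ← ENNReal.tsum_mul_right]
  refine tsum_congr fun γ => ?_
  rw [hP.cyl_inter_shift x m _ hB, hv _ γ.2]

lemma IsSRW.start (hP : IsSRW d P) {x y : Zd d} (h : y ≠ x) : P x {ω | ω 0 = y} = 0 := by
  have := hP.2.2 x 0 (fun _ => y) (fun h' => h h'.1)
  simpa using this

lemma IsSRW.ae_start (hP : IsSRW d P) (x : Zd d) : ∀ᵐ ω ∂P x, ω 0 = x := by
  have hcov : {ω : ℕ → Zd d | ¬ ω 0 = x} ⊆ ⋃ y : {y : Zd d // y ≠ x}, {ω | ω 0 = y.1} :=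
    fun ω hω => Set.mem_iUnion.2 ⟨⟨ω 0, hω⟩, rfl⟩
  exact measure_mono_null hcov (measure_iUnion_null fun y => hP.start y.2)

lemma adj_comm {x y : Zd d} : adj x y ↔ adj y x := by
  simp only [adj, abs_sub_comm]

lemma adj.exists_single {x y : Zd d} (h : adj x y) :
    ∃ i, y = x + Pi.single i 1 ∨ y = x - Pi.single i 1 := by
  have hne : ∃ i, x i - y i ≠ 0 := by
    by_contra hcon
    push Not at hcon
    simp [adj, hcon] at h
  obtain ⟨i, hi⟩ := hne
  have hsplit := Finset.add_sum_erase Finset.univ (fun i => |x i - y i|) (Finset.mem_univ i)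
  have hpos : 0 < |x i - y i| := abs_pos.2 hi
  have hnn : 0 ≤ ∑ j ∈ Finset.univ.erase i, |x j - y j| := Finset.sum_nonneg fun _ _ => abs_nonneg _
  have h' : ∑ i, |x i - y i| = 1 := h
  have h1 : |x i - y i| = 1 := by omega
  have h0 : ∑ j ∈ Finset.univ.erase i, |x j - y j| = 0 := by omega
  have hj : ∀ j, j ≠ i → y j = x j := by
    intro j hj
    have := (Finset.sum_eq_zero_iff_of_nonneg fun _ _ => abs_nonneg _).1 h0 j (by simp [hj])
    have := abs_eq_zero.1 this
    omega
  refine ⟨i, ?_⟩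
  rcases (abs_eq one_pos.le).1 h1 with h2 | h2
  · right
    ext j
    by_cases hji : j = i
    · subst hji; simp; omega
    · simp [hji, hj j hji]
  · left
    ext j
    by_cases hji : j = i
    · subst hji; simp; omega
    · simp [hji, hj j hji]

lemma IsSRW.measure_step_le (hP : IsSRW d P) (x y : Zd d) :
    P x {ω | ω 1 = y} ≤ (2 * d : ENNReal)⁻¹ := by
  have h1 : P x {ω | ω 1 = y} ≤ P x (cyl 1 fun k => if k = 0 then x else y) := by
    refine measure_mono_ae ?_
    filter_upwards [hP.ae_start x] with ω hω h k hk
    have h : ω 1 = y := h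
    interval_cases k <;> simp [hω, h]
  refine h1.trans ?_
  by_cases h : (fun k : ℕ => if k = 0 then x else y) 0 = x ∧ ∀ k < 1,
      adj ((fun k : ℕ => if k = 0 then x else y) k) ((fun k : ℕ => if k = 0 then x else y) (k + 1))
  · exact ((hP.2.1 x 1 _ h).trans (pow_one _)).le
  · exact (hP.2.2 x 1 _ h).trans_le zero_le

lemma IsSRW.ae_adj (hP : IsSRW d P) (x : Zd d) : ∀ᵐ ω ∂P x, adj x (ω 1) := by
  have hcov : {ω : ℕ → Zd d | ¬ adj x (ω 1)} ⊆ {ω | ¬ ω 0 = x} ∪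
      ⋃ y : {y : Zd d // ¬ adj x y}, cyl 1 fun k => if k = 0 then x else y := by
    intro ω hω
    by_cases h0 : ω 0 = x
    · refine Or.inr (Set.mem_iUnion.2 ⟨⟨ω 1, hω⟩, fun k hk => ?_⟩)
      interval_cases k <;> simp [h0]
    · exact Or.inl h0
  refine measure_mono_null hcov (measure_union_null (hP.ae_start x)
    (measure_iUnion_null fun y => hP.2.2 x 1 _ ?_))
  intro h
  exact y.2 (by simpa using h.2 0 one_pos)

/-- First step analysis. -/
lemma IsSRW.measure_shift_one_le (hP : IsSRW d P) (x : Zd d) {B : Set (ℕ → Zd d)}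
    (hB : MeasurableSet B) :
    P x (shift 1 ⁻¹' B) ≤ ∑ i, (2 * d : ENNReal)⁻¹ *
      (P (x + Pi.single i 1) B + P (x - Pi.single i 1) B) := by
  have hdep : ∀ y : Zd d, DependsUpTo 1 {ω : ℕ → Zd d | ω 1 = y} := fun y ω ω' h hω => by
    exact (h 1 le_rfl).symm.trans hω
  have hstep : ∀ y : Zd d, P x ({ω | ω 1 = y} ∩ shift 1 ⁻¹' B) ≤ (2 * d : ENNReal)⁻¹ * P y B :=
    fun y => (hP.markov x (hdep y) (fun ω h => h) hB).trans_le
      (mul_le_mul_left (hP.measure_step_le x y) _)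
  have hcov : P x (shift 1 ⁻¹' B) ≤ P x (⋃ i : Fin d,
      (({ω | ω 1 = x + Pi.single i 1} ∩ shift 1 ⁻¹' B) ∪
        ({ω | ω 1 = x - Pi.single i 1} ∩ shift 1 ⁻¹' B))) := by
    refine measure_mono_ae ?_
    filter_upwards [hP.ae_adj x] with ω hω hB
    obtain ⟨i, hi⟩ := hω.exists_single
    exact Set.mem_iUnion.2 ⟨i, hi.imp (fun h => ⟨h, hB⟩) (fun h => ⟨h, hB⟩)⟩
  refine hcov.trans ((measure_iUnion_le _).trans ?_)
  rw [tsum_fintype]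
  refine Finset.sum_le_sum fun i _ => (measure_union_le _ _).trans ?_
  rw [mul_add]
  exact add_le_add (hstep _) (hstep _)

/-- A superharmonic function controls hitting probabilities. -/
lemma IsSRW.hit_mul_le (hP : IsSRW d P) {h : Zd d → ENNReal} {B : Set (Zd d)} {b : ENNReal}
    (hsup : ∀ x, ∑ i, (2 * d : ENNReal)⁻¹ * (h (x + Pi.single i 1) + h (x - Pi.single i 1)) ≤ h x)
    (hb : ∀ x ∈ B, b ≤ h x) (z : Zd d) : P z {ω | ∃ m, ω m ∈ B} * b ≤ h z := by
  have := hP.1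
  have hin : ∀ (S : Set (ℕ → Zd d)), ∀ z ∈ B, P z S * b ≤ h z := fun S z hz =>
    (mul_le_of_le_one_left zero_le prob_le_one).trans (hb z hz)
  have hfin : ∀ n z, P z {ω | ∃ m ≤ n, ω m ∈ B} * b ≤ h z := by
    intro n
    induction n with
    | zero =>
      intro z
      by_cases hz : z ∈ B
      · exact hin _ z hz
      · have : P z {ω | ∃ m ≤ 0, ω m ∈ B} = 0 := by
          refine measure_mono_null ?_ (hP.ae_start z)
          rintro ω ⟨m, hm, hω⟩ h0
          obtain rfl : m = 0 := by omega
          exact hz (h0 ▸ hω)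
        rw [this, zero_mul]
        exact zero_le
    | succ n ih =>
      intro z
      by_cases hz : z ∈ B
      · exact hin _ z hz
      · have hmeas : MeasurableSet {ω : ℕ → Zd d | ∃ m ≤ n, ω m ∈ B} := by
          refine DependsUpTo.measurableSet (m := n) fun ω ω' h => ?_
          rintro ⟨m, hm, hω⟩
          exact ⟨m, hm, h m hm ▸ hω⟩
        have hle : P z {ω | ∃ m ≤ n + 1, ω m ∈ B} ≤
            P z (shift 1 ⁻¹' {ω | ∃ m ≤ n, ω m ∈ B}) := by
          refine measure_mono_ae ?_
          filter_upwards [hP.ae_start z] with ω h0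
          rintro ⟨m, hm, hω⟩
          have hm0 : m ≠ 0 := by rintro rfl; exact hz (h0 ▸ hω)
          refine ⟨m - 1, by omega, ?_⟩
          simpa [shift, show 1 + (m - 1) = m by omega] using hω
        refine (mul_le_mul_left (hle.trans (hP.measure_shift_one_le z hmeas)) b).trans ?_
        refine le_trans ?_ (hsup z)
        rw [Finset.sum_mul]
        refine Finset.sum_le_sum fun i _ => ?_
        rw [mul_assoc, add_mul]
        gcongr <;> exact ih _
  have hU : {ω : ℕ → Zd d | ∃ m, ω m ∈ B} = ⋃ n, {ω | ∃ m ≤ n, ω m ∈ B} := by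
    ext ω
    rw [Set.mem_iUnion]
    exact ⟨fun ⟨m, hm⟩ => ⟨m, m, le_rfl, hm⟩, fun ⟨_, m, _, hm⟩ => ⟨m, hm⟩⟩
  have hmono : Monotone fun n => {ω : ℕ → Zd d | ∃ m ≤ n, ω m ∈ B} :=
    fun n n' hn ω ⟨m, hm, hω⟩ => ⟨m, hm.trans hn, hω⟩
  rw [hU, hmono.measure_iUnion, ENNReal.iSup_mul]
  exact iSup_le fun n => hfin n z

/-- A strictly superharmonic function controls the Green function. -/
lemma IsSRW.mul_green_le (hP : IsSRW d P) {h : Zd d → ENNReal} {y : Zd d} {b : ENNReal}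
    (hsup : ∀ x, (if x = y then b else 0) +
      ∑ i, (2 * d : ENNReal)⁻¹ * (h (x + Pi.single i 1) + h (x - Pi.single i 1)) ≤ h x)
    (z : Zd d) : b * ∑' m, P z {ω | ω m = y} ≤ h z := by
  have := hP.1
  have hfin : ∀ n z, b * ∑ m ∈ Finset.range n, P z {ω | ω m = y} ≤ h z := by
    intro n
    induction n with
    | zero => intro z; simp
    | succ n ih =>
      intro z
      refine le_trans ?_ (hsup z)
      rw [Finset.sum_range_succ', mul_add, add_comm]
      refine add_le_add ?_ ?_
      · split_ifs with hz
        · exact mul_le_of_le_one_right zero_le prob_le_one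
        · rw [hP.start (Ne.symm hz), mul_zero]
      · have hstep : ∀ m, P z {ω | ω (m + 1) = y} ≤ ∑ i, (2 * d : ENNReal)⁻¹ *
            (P (z + Pi.single i 1) {ω | ω m = y} + P (z - Pi.single i 1) {ω | ω m = y}) := by
          intro m
          have := hP.measure_shift_one_le z (measurableSet_eval m {y})
          simpa [shift, add_comm 1 m] using this
        calc b * ∑ m ∈ Finset.range n, P z {ω | ω (m + 1) = y}
            ≤ b * ∑ m ∈ Finset.range n, ∑ i, (2 * d : ENNReal)⁻¹ *
            (P (z + Pi.single i 1) {ω | ω m = y} + P (z - Pi.single i 1) {ω | ω m = y}) := by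
              gcongr with m; exact hstep m
          _ = ∑ i, (2 * d : ENNReal)⁻¹ *
            (b * ∑ m ∈ Finset.range n, P (z + Pi.single i 1) {ω | ω m = y} +
              b * ∑ m ∈ Finset.range n, P (z - Pi.single i 1) {ω | ω m = y}) := by
              rw [Finset.sum_comm, Finset.mul_sum]
              refine Finset.sum_congr rfl fun i _ => ?_
              rw [← Finset.mul_sum, Finset.sum_add_distrib, ← mul_add]
              ring
          _ ≤ _ := by gcongr <;> exact ih _
  rw [ENNReal.tsum_eq_iSup_nat, ENNReal.mul_iSup]
  exact iSup_le fun n => hfin n z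

lemma extend_rev {m : ℕ} (γ : Fin (m + 1) → Zd d) :
    extend (fun i => γ i.rev) = fun k => extend γ (m - k) := by
  funext k
  simp only [extend]
  congr 1
  ext
  simp only [Fin.val_rev]
  omega

/-- Reversibility of the simple random walk. -/
lemma IsSRW.measure_le_of_reverse (hP : IsSRW d P) {x y : Zd d} {m : ℕ} {A A' : Set (ℕ → Zd d)}
    (hA : DependsUpTo m A) (hA' : DependsUpTo m A') (hxy : ∀ ω ∈ A, ω 0 = y ∧ ω m = x)
    (hrev : ∀ ω ∈ A, (∀ k < m, adj (ω k) (ω (k + 1))) → (fun k => ω (m - k)) ∈ A') :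
    P y A ≤ P x A' := by
  have h1 := measure_inter_eq_tsum (P y) hA MeasurableSet.univ
  have h2 := measure_inter_eq_tsum (P x) hA' MeasurableSet.univ
  simp only [Set.inter_univ] at h1 h2
  rw [h1, h2]
  rw [tsum_subtype {γ : Fin (m + 1) → Zd d | extend γ ∈ A} (fun γ => P y (cyl m (extend γ))),
    tsum_subtype {γ : Fin (m + 1) → Zd d | extend γ ∈ A'} (fun γ => P x (cyl m (extend γ))),
    ← ((Fin.revPerm : Equiv.Perm (Fin (m + 1))).arrowCongr (Equiv.refl (Zd d))).tsum_eq
      ({γ : Fin (m + 1) → Zd d | extend γ ∈ A'}.indicator fun γ => P x (cyl m (extend γ)))]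
  refine ENNReal.tsum_le_tsum fun γ => ?_
  have he : ((Fin.revPerm : Equiv.Perm (Fin (m + 1))).arrowCongr (Equiv.refl (Zd d))) γ =
      fun i => γ i.rev := rfl
  rw [he]
  by_cases hγ : extend γ ∈ A
  · by_cases hadj : ∀ k < m, adj (extend γ k) (extend γ (k + 1))
    · have hγ' : (fun i => γ i.rev) ∈ {γ : Fin (m + 1) → Zd d | extend γ ∈ A'} := by
        show extend (fun i => γ i.rev) ∈ A'
        rw [extend_rev]
        exact hrev _ hγ hadj
      rw [Set.indicator_of_mem (show γ ∈ {γ | extend γ ∈ A} from hγ),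
        Set.indicator_of_mem hγ', extend_rev, cyl, cyl, hP.2.1 y m _ ⟨(hxy _ hγ).1, hadj⟩,
        hP.2.1 x m]
      refine ⟨by simpa using (hxy _ hγ).2, fun k hk => ?_⟩
      have := hadj (m - (k + 1)) (by omega)
      rw [show m - (k + 1) + 1 = m - k by omega] at this
      exact adj_comm.1 this
    · rw [Set.indicator_of_mem (show γ ∈ {γ | extend γ ∈ A} from hγ), cyl,
        hP.2.2 y m _ fun h => hadj h.2]
      exact zero_le
  · rw [Set.indicator_of_notMem (show γ ∉ {γ | extend γ ∈ A} from hγ)]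
    exact zero_le

/-- The path enters `V` at time `m`, at the point `v`. -/
def entersAt (V : Set (Zd d)) (m : ℕ) (v : Zd d) : Set (ℕ → Zd d) :=
  {ω | ω m = v ∧ ∀ j < m, ω j ∉ V}

/-- The path leaves `U` at time `m`, through the boundary point `z`, without having returned
to `V`. -/
def exitsAt (V U : Set (Zd d)) (m : ℕ) (z : Zd d) : Set (ℕ → Zd d) :=
  {ω | ω m = z ∧ z ∈ bdry U ∧ (∀ j < m, ω j ∈ U) ∧ ∀ j ≤ m, 1 ≤ j → ω j ∉ V}

lemma dependsUpTo_entersAt (V : Set (Zd d)) (m : ℕ) (v : Zd d) :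
    DependsUpTo m (entersAt V m v) := fun _ _ h hω =>
  ⟨(h m le_rfl).symm.trans hω.1, fun j hj => h j hj.le ▸ hω.2 j hj⟩

lemma dependsUpTo_exitsAt (V U : Set (Zd d)) (m : ℕ) (z : Zd d) :
    DependsUpTo m (exitsAt V U m z) := fun _ _ h hω =>
  ⟨(h m le_rfl).symm.trans hω.1, hω.2.1, fun j hj => h j hj.le ▸ hω.2.2.1 j hj,
    fun j hj hj1 => h j hj ▸ hω.2.2.2 j hj hj1⟩

lemma measurableSet_avoid (V : Set (Zd d)) (n : ℕ) :
    MeasurableSet {ω : ℕ → Zd d | ∀ k, n ≤ k → ω k ∉ V} := by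
  have : {ω : ℕ → Zd d | ∀ k, n ≤ k → ω k ∉ V} = ⋂ k, ⋂ (_ : n ≤ k), {ω | ω k ∈ Vᶜ} := by
    ext ω; simp
  rw [this]
  exact MeasurableSet.iInter fun k => MeasurableSet.iInter fun _ => measurableSet_eval k _

/-- Time reversal of the entrance in `V`. -/
lemma IsSRW.entersAt_le (hP : IsSRW d P) (V : Set (Zd d)) (m : ℕ) (v y : Zd d) :
    P y (entersAt V m v) ≤ P v {ω | ω 0 = v ∧ ω m = y ∧ (∀ j ≤ m, 1 ≤ j → ω j ∉ V) ∧
      ∀ j < m, adj (ω j) (ω (j + 1))} := by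
  have h1 : P y (entersAt V m v) ≤ P y {ω | ω 0 = y ∧ ω ∈ entersAt V m v} := by
    refine measure_mono_ae ?_
    filter_upwards [hP.ae_start y] with ω h0 hω using ⟨h0, hω⟩
  refine h1.trans (hP.measure_le_of_reverse (m := m) ?_ ?_ (fun ω hω => ⟨hω.1, hω.2.1⟩) ?_)
  · exact fun ω ω' h hω => ⟨(h 0 (Nat.zero_le _)).symm.trans hω.1,
      dependsUpTo_entersAt V m v _ _ h hω.2⟩
  · rintro ω ω' h ⟨h0, hm, hV, hadj⟩
    refine ⟨(h 0 (Nat.zero_le _)).symm.trans h0, (h m le_rfl).symm.trans hm,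
      fun j hj hj1 => h j hj ▸ hV j hj hj1, fun j hj => ?_⟩
    rw [← h j hj.le, ← h (j + 1) hj]
    exact hadj j hj
  · rintro ω ⟨h0, hm, hV⟩ hadj
    refine ⟨by simpa using hm, by simpa using h0, fun j hj hj1 => hV _ (by omega), fun j hj => ?_⟩
    have := hadj (m - (j + 1)) (by omega)
    rw [show m - (j + 1) + 1 = m - j by omega] at this
    exact adj_comm.1 this

/-- A path from `V ⊆ U` to the complement of `U` not returning to `V` decomposes at its exit
from `U`. -/
lemma exists_mem_exitsAt {V U : Set (Zd d)} {N : ℕ} {ω : ℕ → Zd d} (h0 : ω 0 ∈ U)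
    (hN : ω N ∉ U) (hV : ∀ j ≤ N, 1 ≤ j → ω j ∉ V) (hadj : ∀ j < N, adj (ω j) (ω (j + 1))) :
    ∃ m ≤ N, ω ∈ exitsAt V U m (ω m) := by
  classical
  have hex : ∃ m, ω m ∉ U := ⟨N, hN⟩
  have hmN : Nat.find hex ≤ N := Nat.find_min' hex hN
  have hm := Nat.find_spec hex
  have hmin : ∀ j < Nat.find hex, ω j ∈ U := fun j hj => not_not.1 (Nat.find_min hex hj)
  have hpos : Nat.find hex ≠ 0 := fun h => by rw [h] at hm; exact hm h0
  refine ⟨Nat.find hex, hmN, rfl, ⟨hm, ω (Nat.find hex - 1), hmin _ (by omega), ?_⟩, hmin,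
    fun j hj => hV j (hj.trans hmN)⟩
  have := hadj (Nat.find hex - 1) (by omega)
  rw [show Nat.find hex - 1 + 1 = Nat.find hex by omega] at this
  exact adj_comm.1 this

/-- Bound on the entrance law in `V` from far away by the equilibrium measure. -/
lemma IsSRW.tsum_entersAt_mul_le (hP : IsSRW d P) {V U : Set (Zd d)} {v y : Zd d} (hv : v ∈ U)
    (hy : y ∉ U) {G δ : ENNReal} (hG : ∀ z ∈ bdry U, ∑' k, P z {ω | ω k = y} ≤ G)
    (hδ : ∀ z ∈ bdry U, δ ≤ P z {ω | ∀ k, 0 ≤ k → ω k ∉ V}) :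
    (∑' m, P y (entersAt V m v)) * δ ≤ G * P v {ω | ∀ k, 1 ≤ k → ω k ∉ V} := by
  have hexit_le : ∀ (a b : Zd d → ENNReal), (∀ z ∈ bdry U, a z ≤ b z) → ∀ m z,
      P v (exitsAt V U m z) * a z ≤ P v (exitsAt V U m z) * b z := by
    intro a b hab m z
    by_cases hz : z ∈ bdry U
    · exact mul_le_mul_right (hab z hz) _
    · have : exitsAt V U m z = ∅ := Set.eq_empty_of_forall_notMem fun ω hω => hz hω.2.1
      simp [this]
  have hupper : ∑' m, P y (entersAt V m v) ≤ (∑' p : ℕ × Zd d, P v (exitsAt V U p.1 p.2)) * G := by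
    have hN : ∀ N, P y (entersAt V N v) ≤ ∑' p : (ℕ × Zd d) × ℕ, if N = p.1.1 + p.2 then
        P v (exitsAt V U p.1.1 p.1.2 ∩ shift p.1.1 ⁻¹' {ω | ω p.2 = y}) else 0 := by
      intro N
      refine (hP.entersAt_le V N v y).trans ?_
      have hcov : {ω : ℕ → Zd d | ω 0 = v ∧ ω N = y ∧ (∀ j ≤ N, 1 ≤ j → ω j ∉ V) ∧
          ∀ j < N, adj (ω j) (ω (j + 1))} ⊆ ⋃ p : (ℕ × Zd d) × ℕ, if N = p.1.1 + p.2 then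
          exitsAt V U p.1.1 p.1.2 ∩ shift p.1.1 ⁻¹' {ω | ω p.2 = y} else ∅ := by
        rintro ω ⟨h0, hNy, hV, hadj⟩
        obtain ⟨m, hm, hω⟩ := exists_mem_exitsAt (h0 ▸ hv) (hNy ▸ hy) hV hadj
        refine Set.mem_iUnion.2 ⟨((m, ω m), N - m), ?_⟩
        rw [if_pos (by simp; omega)]
        exact ⟨hω, by simp [shift, show m + (N - m) = N by omega, hNy]⟩
      refine (measure_mono hcov).trans ((measure_iUnion_le _).trans_eq (tsum_congr fun p => ?_))
      split_ifs <;> simp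
    refine (ENNReal.tsum_le_tsum hN).trans ?_
    rw [ENNReal.tsum_comm]
    simp only [tsum_ite_eq]
    rw [ENNReal.tsum_prod', ← ENNReal.tsum_mul_right]
    refine ENNReal.tsum_le_tsum fun p => ?_
    have hmarkov : ∀ k, P v (exitsAt V U p.1 p.2 ∩ shift p.1 ⁻¹' {ω | ω k = y}) =
        P v (exitsAt V U p.1 p.2) * P p.2 {ω | ω k = y} := fun k =>
      hP.markov v (dependsUpTo_exitsAt V U p.1 p.2) (fun ω hω => hω.1) (measurableSet_eval k {y})
    simp only [hmarkov, ENNReal.tsum_mul_left]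
    exact hexit_le (fun z => ∑' k, P z {ω | ω k = y}) (fun _ => G) hG _ _
  have hlower : (∑' p : ℕ × Zd d, P v (exitsAt V U p.1 p.2)) * δ ≤
      P v {ω | ∀ k, 1 ≤ k → ω k ∉ V} := by
    calc (∑' p : ℕ × Zd d, P v (exitsAt V U p.1 p.2)) * δ
        ≤ ∑' p : ℕ × Zd d, P v (exitsAt V U p.1 p.2 ∩
            shift p.1 ⁻¹' {ω | ∀ k, 0 ≤ k → ω k ∉ V}) := by
          rw [← ENNReal.tsum_mul_right]
          refine ENNReal.tsum_le_tsum fun p => ?_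
          rw [hP.markov v (dependsUpTo_exitsAt V U p.1 p.2) (fun ω hω => hω.1)
            (measurableSet_avoid V 0)]
          exact hexit_le (fun _ => δ) _ hδ _ _
      _ = P v (⋃ p : ℕ × Zd d, exitsAt V U p.1 p.2 ∩
            shift p.1 ⁻¹' {ω | ∀ k, 0 ≤ k → ω k ∉ V}) := by
          refine (measure_iUnion ?_ fun p : ℕ × Zd d =>
            (dependsUpTo_exitsAt V U p.1 p.2).measurableSet.inter
              (measurable_shift _ (measurableSet_avoid V 0))).symm
          have hle : ∀ (p p' : ℕ × Zd d) (ω), ω ∈ exitsAt V U p.1 p.2 →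
              ω ∈ exitsAt V U p'.1 p'.2 → p.1 ≤ p'.1 := by
            intro p p' ω h h'
            by_contra hlt
            have := h.2.2.1 p'.1 (by omega)
            rw [h'.1] at this
            exact h'.2.1.1 this
          intro p p' hne
          refine Set.disjoint_left.2 fun ω h h' => hne ?_
          have h1 := le_antisymm (hle p p' ω h.1 h'.1) (hle p' p ω h'.1 h.1)
          exact Prod.ext h1 (by rw [← h.1.1, ← h'.1.1, h1])
      _ ≤ _ := by
          refine measure_mono (Set.iUnion_subset fun p => ?_)
          rintro ω ⟨h1, h2⟩ k hk
          rcases le_total k p.1 with h | h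
          · exact h1.2.2.2 k h hk
          · have := h2 (k - p.1) (Nat.zero_le _)
            rwa [shift, show p.1 + (k - p.1) = k by omega] at this
  calc (∑' m, P y (entersAt V m v)) * δ
      ≤ (∑' p : ℕ × Zd d, P v (exitsAt V U p.1 p.2)) * G * δ := mul_le_mul_left hupper _
    _ = G * ((∑' p : ℕ × Zd d, P v (exitsAt V U p.1 p.2)) * δ) := by ring
    _ ≤ _ := mul_le_mul_right hlower _

/-- The event that the path enters `V` at the starting point of `w k`, then follows `w k`, then
enters `V` at the starting point of `w (k + 1)`, and so on, for `j` successive paths. -/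
def visits (V : Set (Zd d)) (N : ℕ → ℕ) (w : ℕ → ℕ → Zd d) : ℕ → ℕ → Set (ℕ → Zd d)
  | 0, _ => Set.univ
  | j + 1, k => ⋃ m, entersAt V m (w k 0) ∩
      shift m ⁻¹' (cyl (N k) (w k) ∩ shift (N k) ⁻¹' visits V N w j (k + 1))

lemma measurableSet_visits (V : Set (Zd d)) (N : ℕ → ℕ) (w : ℕ → ℕ → Zd d) (j k : ℕ) :
    MeasurableSet (visits V N w j k) := by
  induction j generalizing k with
  | zero => exact MeasurableSet.univ
  | succ j ih =>
    exact MeasurableSet.iUnion fun m => (dependsUpTo_entersAt V m _).measurableSet.inter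
      (measurable_shift m ((measurableSet_cyl _ _).inter (measurable_shift _ (ih _))))

lemma IsSRW.visits_succ_le (hP : IsSRW d P) (V : Set (Zd d)) (N : ℕ → ℕ) (w : ℕ → ℕ → Zd d)
    (j k : ℕ) (y : Zd d) :
    P y (visits V N w (j + 1) k) ≤ (∑' m, P y (entersAt V m (w k 0))) *
      (P (w k 0) (cyl (N k) (w k)) * P (w k (N k)) (visits V N w j (k + 1))) := by
  have hm := measurableSet_visits V N w j (k + 1)
  refine (measure_iUnion_le _).trans_eq ?_
  rw [← ENNReal.tsum_mul_right]
  refine tsum_congr fun m => ?_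
  rw [hP.markov y (dependsUpTo_entersAt V m _) (fun ω hω => hω.1)
    ((measurableSet_cyl _ _).inter (measurable_shift _ hm)), hP.cyl_inter_shift _ _ _ hm]

lemma IsSRW.visits_le (hP : IsSRW d P) {V U : Set (Zd d)} {N : ℕ → ℕ} {w : ℕ → ℕ → Zd d}
    {q : Zd d → ENNReal} (hw0 : ∀ k, w k 0 ∈ V) (hwN : ∀ k, w k (N k) ∉ U)
    (hq : ∀ v ∈ V, ∀ y ∉ U, ∑' m, P y (entersAt V m v) ≤ q v) (j k : ℕ) {y : Zd d} (hy : y ∉ U) :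
    P y (visits V N w j k) ≤
      ∏ i ∈ Finset.range j, q (w (k + i) 0) * P (w (k + i) 0) (cyl (N (k + i)) (w (k + i))) := by
  have := hP.1
  induction j generalizing k y with
  | zero => simpa using prob_le_one
  | succ j ih =>
    refine (hP.visits_succ_le V N w j k y).trans ?_
    rw [Finset.prod_range_succ', mul_comm (∏ i ∈ _, _), add_zero, mul_assoc]
    refine mul_le_mul' (hq _ (hw0 k) y hy) (mul_le_mul' le_rfl ?_)
    simpa only [add_assoc, add_comm 1] using ih (k + 1) (hwN k)

lemma IsSRW.tsum_entersAt_of_mem (hP : IsSRW d P) {V : Set (Zd d)} {x : Zd d} (hx : x ∈ V)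
    (v : Zd d) : ∑' m, P x (entersAt V m v) ≤ if x = v then 1 else 0 := by
  have := hP.1
  have h0 : ∀ m ≠ 0, P x (entersAt V m v) = 0 := by
    intro m hm
    refine measure_mono_null ?_ (hP.ae_start x)
    intro ω hω h
    exact hω.2 0 (Nat.pos_of_ne_zero hm) (h ▸ hx)
  rw [tsum_eq_single 0 h0]
  split_ifs with h
  · exact prob_le_one
  · refine (measure_mono fun ω hω => ?_).trans_eq (hP.start (Ne.symm h))
    exact hω.1

lemma nextIn_spec {A : Set (Zd d)} {ω : ℕ → Zd d} {t r : ℕ} (h : nextIn A ω t = r) :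
    t ≤ r ∧ ω r ∈ A ∧ ∀ i, t ≤ i → i < r → ω i ∉ A := by
  have hle : ∀ i, t ≤ i → ω i ∈ A → r ≤ i := fun i hi hA => by
    have : nextIn A ω t ≤ i := iInf₂_le i ⟨by exact_mod_cast hi, hA⟩
    rw [h] at this
    exact_mod_cast this
  have hex : ∃ m, t ≤ m ∧ ω m ∈ A ∧ m ≤ r := by
    by_contra! hcon
    have : ((r + 1 : ℕ) : ℕ∞) ≤ nextIn A ω t := le_iInf₂ fun m hm => by
      have := hcon m (by exact_mod_cast hm.1) hm.2
      exact_mod_cast this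
    rw [h] at this
    have : r + 1 ≤ r := by exact_mod_cast this
    omega
  obtain ⟨m, htm, hmA, hmr⟩ := hex
  obtain rfl : m = r := le_antisymm hmr (hle m htm hmA)
  exact ⟨htm, hmA, fun i hti hir hA => by have := hle i hti hA; omega⟩

lemma mem_visits {V U : Set (Zd d)} {N : ℕ → ℕ} {w : ℕ → ℕ → Zd d} {ω : ℕ → Zd d} {l : ℕ}
    (h : ∀ k < l, ∃ r : ℕ, (RD V U ω (k + 1)).1 = r ∧ (RD V U ω (k + 1)).2 = (r + N k : ℕ) ∧
      ∀ j ≤ N k, ω (r + j) = w k j) (j k t : ℕ) (hl : k + j = l) (ht : (RD V U ω k).2 = t) :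
    shift t ω ∈ visits V N w j k := by
  induction j generalizing k t with
  | zero => exact Set.mem_univ _
  | succ j ih =>
    obtain ⟨r, h1, h2, h3⟩ := h k (by omega)
    have hnext : nextIn V ω (RD V U ω k).2 = r := h1
    rw [ht] at hnext
    obtain ⟨htr, -, hbefore⟩ := nextIn_spec hnext
    refine Set.mem_iUnion.2 ⟨r - t, ⟨?_, fun i hi => hbefore _ (by omega) (by omega)⟩, ?_, ?_⟩
    · simpa [shift, show t + (r - t) = r by omega] using h3 0 (Nat.zero_le _)
    · intro i hi
      simpa [shift, ← add_assoc, show t + (r - t) = r by omega] using h3 i hi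
    · have := ih (k + 1) _ (by omega) h2
      have he : shift (N k) (shift (r - t) (shift t ω)) = shift (r + N k) ω := by
        funext i
        simp only [shift]
        congr 1
        omega
      rwa [Set.mem_preimage, he]

/-- A bound on entrance laws yields the bound on the intensity of successive excursions. -/
lemma IsSRW.sum_eqm_mul_le (hP : IsSRW d P) {V U : Set (Zd d)} {F : Finset (Zd d)}
    (hF : ∀ x, x ∈ F ↔ x ∈ V) {K : ℝ} (hK0 : 0 ≤ K)
    (hK : ∀ v ∈ V, ∀ y ∉ U, ∑' m, P y (entersAt V m v) ≤
      ENNReal.ofReal K * P v {ω | ∀ n, 1 ≤ n → ω n ∉ V})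
    {l : ℕ} (hl : 0 < l) (Nw : Fin l → ℕ) (w : Fin l → ℕ → Zd d)
    (hw : ∀ k : Fin l, inT V U (Nw k) (w k)) :
    (∑ x ∈ F, eqm P V x * (P x {ω | ∀ k : Fin l, ∃ r : ℕ,
        (RD V U ω ((k : ℕ) + 1)).1 = (r : ℕ∞) ∧
        (RD V U ω ((k : ℕ) + 1)).2 = ((r + Nw k : ℕ) : ℕ∞) ∧
        ∀ j ≤ Nw k, ω (r + j) = w k j}).toReal) ≤
      K ^ (l - 1) * ∏ k : Fin l, (∑ x ∈ F, eqm P V x * (P x {ω |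
        (∀ j < Nw k, ω j ∈ U) ∧ ω (Nw k) ∉ U ∧ ∀ j ≤ Nw k, ω j = w k j}).toReal) := by
  have := hP.1
  obtain ⟨j, rfl⟩ : ∃ j, l = j + 1 := ⟨l - 1, by omega⟩
  have heqm0 : ∀ x, 0 ≤ eqm P V x := fun x =>
    Set.indicator_nonneg (fun _ _ => ENNReal.toReal_nonneg) x
  have heqm : ∀ v ∈ V, (P v {ω | ∀ n, 1 ≤ n → ω n ∉ V}).toReal = eqm P V v := fun v hv => by
    rw [eqm, Set.indicator_of_mem hv]
  let N' : ℕ → ℕ := fun k => if h : k < j + 1 then Nw ⟨k, h⟩ else Nw 0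
  let w' : ℕ → ℕ → Zd d := fun k => if h : k < j + 1 then w ⟨k, h⟩ else w 0
  have hw' : ∀ k, inT V U (N' k) (w' k) := fun k => by
    simp only [N', w']
    split_ifs with h
    · exact hw _
    · exact hw 0
  have hN'f : ∀ k : Fin (j + 1), N' k = Nw k := fun k => dif_pos k.2
  have hw'f : ∀ k : Fin (j + 1), w' k = w k := fun k => dif_pos k.2
  let p : ℕ → ℝ := fun k => (P (w' k 0) (cyl (N' k) (w' k))).toReal
  have hp0 : ∀ k, 0 ≤ p k := fun k => ENNReal.toReal_nonneg
  have hvis : (P (w' 0 (N' 0)) (visits V N' w' j 1)).toReal ≤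
      ∏ i ∈ Finset.range j, K * eqm P V (w' (i + 1) 0) * p (i + 1) := by
    have h1 := hP.visits_le (fun k => (hw' k).1) (fun k => (hw' k).2.1.1) hK j 1 (hw' 0).2.1.1
    have h2 := ENNReal.toReal_mono ?_ h1
    · refine h2.trans_eq ?_
      rw [ENNReal.toReal_prod]
      refine Finset.prod_congr rfl fun i _ => ?_
      rw [ENNReal.toReal_mul, ENNReal.toReal_mul, ENNReal.toReal_ofReal hK0,
        heqm _ (hw' _).1, add_comm 1 i]
    · exact ENNReal.prod_ne_top fun i _ => ENNReal.mul_ne_top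
        (ENNReal.mul_ne_top ENNReal.ofReal_ne_top (measure_ne_top _ _)) (measure_ne_top _ _)
  have hupper : (∑ x ∈ F, eqm P V x * (P x {ω | ∀ k : Fin (j + 1), ∃ r : ℕ,
        (RD V U ω ((k : ℕ) + 1)).1 = (r : ℕ∞) ∧
        (RD V U ω ((k : ℕ) + 1)).2 = ((r + Nw k : ℕ) : ℕ∞) ∧
        ∀ i ≤ Nw k, ω (r + i) = w k i}).toReal) ≤
      eqm P V (w' 0 0) * (p 0 * ∏ i ∈ Finset.range j, K * eqm P V (w' (i + 1) 0) * p (i + 1)) := by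
    have hone : ∀ x ∈ F, eqm P V x * (P x {ω | ∀ k : Fin (j + 1), ∃ r : ℕ,
        (RD V U ω ((k : ℕ) + 1)).1 = (r : ℕ∞) ∧
        (RD V U ω ((k : ℕ) + 1)).2 = ((r + Nw k : ℕ) : ℕ∞) ∧
        ∀ i ≤ Nw k, ω (r + i) = w k i}).toReal ≤ if x = w' 0 0 then
          eqm P V (w' 0 0) * (p 0 * ∏ i ∈ Finset.range j, K * eqm P V (w' (i + 1) 0) * p (i + 1))
          else 0 := by
      intro x hx
      have hsub : {ω : ℕ → Zd d | ∀ k : Fin (j + 1), ∃ r : ℕ,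
          (RD V U ω ((k : ℕ) + 1)).1 = (r : ℕ∞) ∧
          (RD V U ω ((k : ℕ) + 1)).2 = ((r + Nw k : ℕ) : ℕ∞) ∧
          ∀ i ≤ Nw k, ω (r + i) = w k i} ⊆ visits V N' w' (j + 1) 0 := by
        intro ω hω
        have := mem_visits (V := V) (U := U) (N := N') (w := w') (ω := ω) (l := j + 1)
          (fun k hk => by
            have h := hω ⟨k, hk⟩
            rw [← hN'f, ← hw'f] at h
            exact h) (j + 1) 0 0 (by omega) rfl
        have he : shift 0 ω = ω := by funext i; simp [shift]
        rwa [he] at this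
      have hle := (measure_mono (μ := P x) hsub).trans ((hP.visits_succ_le V N' w' j 0 x).trans
        (mul_le_mul_left (hP.tsum_entersAt_of_mem ((hF x).1 hx) (w' 0 0)) _))
      split_ifs at hle ⊢ with hxw
      · subst hxw
        refine mul_le_mul_of_nonneg_left ?_ (heqm0 _)
        rw [one_mul] at hle
        refine (ENNReal.toReal_mono (ENNReal.mul_ne_top (measure_ne_top _ _)
          (measure_ne_top _ _)) hle).trans ?_
        rw [ENNReal.toReal_mul]
        exact mul_le_mul_of_nonneg_left hvis (hp0 0)
      · rw [zero_mul, nonpos_iff_eq_zero] at hle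
        rw [hle]
        simp
    refine (Finset.sum_le_sum hone).trans_eq ?_
    rw [Finset.sum_ite_eq', if_pos ((hF _).2 (hw' 0).1)]
  have hlower : ∀ k : Fin (j + 1), eqm P V (w' k 0) * p k ≤
      ∑ x ∈ F, eqm P V x * (P x {ω |
        (∀ i < Nw k, ω i ∈ U) ∧ ω (Nw k) ∉ U ∧ ∀ i ≤ Nw k, ω i = w k i}).toReal := by
    intro k
    have hcyl : {ω : ℕ → Zd d | (∀ i < Nw k, ω i ∈ U) ∧ ω (Nw k) ∉ U ∧ ∀ i ≤ Nw k, ω i = w k i} =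
        cyl (Nw k) (w k) := by
      ext ω
      refine ⟨fun h => h.2.2, fun h => ⟨fun i hi => ?_, ?_, h⟩⟩
      · rw [h i hi.le]; exact (hw k).2.2.1 i hi
      · rw [h _ le_rfl]; exact (hw k).2.1.1
    simp only [hcyl, p, hN'f, hw'f]
    exact Finset.single_le_sum (f := fun x => eqm P V x * (P x (cyl (Nw k) (w k))).toReal)
      (fun x _ => mul_nonneg (heqm0 x) ENNReal.toReal_nonneg) ((hF _).2 (hw k).1)
  refine hupper.trans ?_
  refine le_trans (le_of_eq ?_) (mul_le_mul_of_nonneg_left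
    (Finset.prod_le_prod (fun k _ => mul_nonneg (heqm0 _) (hp0 _)) fun k _ => hlower k)
    (pow_nonneg hK0 _))
  rw [Fin.prod_univ_eq_prod_range (fun k => eqm P V (w' k 0) * p k), Finset.prod_range_succ']
  simp only [mul_assoc, Finset.prod_mul_distrib, Finset.prod_const, Finset.card_range,
    Nat.add_sub_cancel]
  ring

end Walk

lemma ofReal_superharmonic {d : ℕ} (hd : 0 < d) {f : Zd d → ℝ} (hf : ∀ x, 0 ≤ f x) {b : ℝ}
    (hb : 0 ≤ b) {x : Zd d}
    (h : 2 * d * b + ∑ i, (f (x + Pi.single i 1) + f (x - Pi.single i 1)) ≤ 2 * d * f x) :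
    ENNReal.ofReal b + ∑ i, (2 * d : ENNReal)⁻¹ *
      (ENNReal.ofReal (f (x + Pi.single i 1)) + ENNReal.ofReal (f (x - Pi.single i 1))) ≤
      ENNReal.ofReal (f x) := by
  have hd' : (0 : ℝ) < d := by exact_mod_cast hd
  have h2d : (2 * d : ENNReal)⁻¹ = ENNReal.ofReal (2 * d : ℝ)⁻¹ := by
    rw [ENNReal.ofReal_inv_of_pos (by positivity), ENNReal.ofReal_mul zero_le_two]
    simp
  have hsum : ∑ i, (2 * d : ENNReal)⁻¹ *
      (ENNReal.ofReal (f (x + Pi.single i 1)) + ENNReal.ofReal (f (x - Pi.single i 1))) =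
      ENNReal.ofReal ((2 * d : ℝ)⁻¹ * ∑ i, (f (x + Pi.single i 1) + f (x - Pi.single i 1))) := by
    rw [← Finset.mul_sum, ENNReal.ofReal_mul (by positivity), h2d,
      ENNReal.ofReal_sum_of_nonneg fun i _ => add_nonneg (hf _) (hf _)]
    simp only [ENNReal.ofReal_add (hf _) (hf _)]
  rw [hsum, ← ENNReal.ofReal_add hb (mul_nonneg (by positivity)
    (Finset.sum_nonneg fun i _ => add_nonneg (hf _) (hf _)))]
  refine ENNReal.ofReal_le_ofReal ?_
  have : b + (2 * d : ℝ)⁻¹ * ∑ i, (f (x + Pi.single i 1) + f (x - Pi.single i 1)) =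
      (2 * d : ℝ)⁻¹ * (2 * d * b + ∑ i, (f (x + Pi.single i 1) + f (x - Pi.single i 1))) := by
    field_simp
  rw [this, inv_mul_le_iff₀ (by positivity)]
  exact h

section Potential

variable {d : ℕ} {a : ℝ}

lemma potential_nonneg (ha : 0 < a) (x : Zd d) : 0 ≤ potential d a x :=
  Real.rpow_nonneg (add_nonneg (sqNorm_nonneg x) ha.le) _

lemma potential_le (hd : 3 ≤ d) (ha : 0 < a) {x : Zd d} {R : ℝ} (hR : 0 < R) {j : Fin d}
    (hj : R ≤ |(x j : ℝ)|) : potential d a x ≤ R ^ (-((d : ℝ) - 2)) := by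
  have hd' : (3 : ℝ) ≤ d := by exact_mod_cast hd
  have h1 : R ^ 2 ≤ sqNorm x + a := by
    have := sq_le_sqNorm x j
    have : R ^ 2 ≤ (x j : ℝ) ^ 2 := by
      rw [← sq_abs (x j : ℝ)]
      exact pow_le_pow_left₀ hR.le hj 2
    linarith
  refine (Real.rpow_le_rpow_of_nonpos (by positivity) h1 (by linarith)).trans_eq ?_
  rw [← Real.rpow_natCast, ← Real.rpow_mul hR.le]
  congr 1
  push_cast
  ring

lemma le_potential (hd : 3 ≤ d) (ha : 0 < a) {x : Zd d} {M : ℝ}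
    (hx : ∀ j, |(x j : ℝ)| ≤ M) :
    (d * M ^ 2 + a) ^ (-(((d : ℝ) - 2) / 2)) ≤ potential d a x := by
  have hd' : (3 : ℝ) ≤ d := by exact_mod_cast hd
  have h0 := sqNorm_nonneg x
  refine Real.rpow_le_rpow_of_nonpos (by linarith) ?_ (by linarith)
  have : sqNorm x ≤ ∑ _i : Fin d, M ^ 2 := Finset.sum_le_sum fun i _ => by
    rw [← sq_abs]
    exact pow_le_pow_left₀ (abs_nonneg _) (hx i) 2
  simp at this
  linarith

variable {P : Zd d → Measure (ℕ → Zd d)}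

/-- Decay of the Green function. -/
lemma IsSRW.green_le (hP : IsSRW d P) (hd : 3 ≤ d) (ha : 0 < a)
    (hsup : ∀ x : Zd d, ∑ i, (potential d a (x + Pi.single i 1) +
      potential d a (x - Pi.single i 1)) ≤ 2 * d * potential d a x)
    {y z : Zd d} {R : ℝ} (hR : 0 < R) {j : Fin d} (hj : R ≤ |(z j : ℝ) - y j|) :
    ∑' m, P z {ω | ω m = y} ≤
      ENNReal.ofReal ((a ^ (-(((d : ℝ) - 2) / 2)) - (1 + a) ^ (-(((d : ℝ) - 2) / 2)))⁻¹ *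
        R ^ (-((d : ℝ) - 2))) := by
  have hd' : (3 : ℝ) ≤ d := by exact_mod_cast hd
  have hκ : 0 < a ^ (-(((d : ℝ) - 2) / 2)) - (1 + a) ^ (-(((d : ℝ) - 2) / 2)) :=
    sub_pos.2 (Real.rpow_lt_rpow_of_neg ha (by linarith) (by linarith))
  set κ := a ^ (-(((d : ℝ) - 2) / 2)) - (1 + a) ^ (-(((d : ℝ) - 2) / 2)) with hκdef
  have hgreen := hP.mul_green_le (h := fun x => ENNReal.ofReal (potential d a (x - y))) (y := y)
    (b := ENNReal.ofReal κ) (fun x => ?_) z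
  · have h2 : ENNReal.ofReal (potential d a (z - y)) ≤ ENNReal.ofReal (R ^ (-((d : ℝ) - 2))) :=
      ENNReal.ofReal_le_ofReal (potential_le hd ha hR (j := j) (by simpa using hj))
    rw [ENNReal.ofReal_mul (inv_nonneg.2 hκ.le), ENNReal.ofReal_inv_of_pos hκ,
      ← ENNReal.div_eq_inv_mul, ENNReal.le_div_iff_mul_le
        (Or.inl (ENNReal.ofReal_pos.2 hκ).ne') (Or.inl ENNReal.ofReal_ne_top), mul_comm]
    exact hgreen.trans h2
  · have hb : (if x = y then ENNReal.ofReal κ else 0) =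
        ENNReal.ofReal (if x = y then κ else 0) := by
      split_ifs <;> simp
    rw [hb]
    refine ofReal_superharmonic (by omega) (f := fun x => potential d a (x - y))
      (fun x => potential_nonneg ha _) (by split_ifs <;> simp [hκ.le]) ?_
    split_ifs with hxy
    · subst hxy
      have hp : ∀ i : Fin d, sqNorm (Pi.single i 1 : Zd d) = 1 := fun i => by
        simp [sqNorm, Pi.single_apply]
      have hm : ∀ i : Fin d, sqNorm (-Pi.single i 1 : Zd d) = 1 := fun i => by
        simp [sqNorm, Pi.single_apply]
      have h0 : sqNorm (0 : Zd d) = 0 := by simp [sqNorm]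
      simp only [potential, add_sub_cancel_left, sub_sub_cancel_left, hp, hm, sub_self, h0]
      simp only [Finset.sum_const, Finset.card_univ, Fintype.card_fin, nsmul_eq_mul, hκdef,
        zero_add]
      apply le_of_eq
      ring
    · have := hsup (x - y)
      simpa only [mul_zero, zero_add, sub_add_eq_add_sub, sub_right_comm x _ y] using this

/-- The probability to hit a box from far away is small. -/
lemma IsSRW.hit_box_le (hP : IsSRW d P) (hd : 3 ≤ d) (ha : 0 < a)
    (hsup : ∀ x : Zd d, ∑ i, (potential d a (x + Pi.single i 1) +
      potential d a (x - Pi.single i 1)) ≤ 2 * d * potential d a x)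
    {c z : Zd d} {R M : ℝ} (hR : 0 < R) (hRM : 16 * (d * M ^ 2 + a) ≤ R ^ 2) {j : Fin d}
    (hj : R ≤ |(z j : ℝ) - c j|) :
    P z {ω | ∃ m, ω m ∈ {x : Zd d | ∀ j, |(x j : ℝ) - c j| ≤ M}} ≤ ENNReal.ofReal (1 / 4) := by
  have hd' : (3 : ℝ) ≤ d := by exact_mod_cast hd
  have hq0 : 0 < d * M ^ 2 + a := by positivity
  set s : ℝ := ((d : ℝ) - 2) / 2 with hs
  have hhit := hP.hit_mul_le (h := fun x => ENNReal.ofReal (potential d a (x - c)))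
    (B := {x : Zd d | ∀ j, |(x j : ℝ) - c j| ≤ M})
    (b := ENNReal.ofReal ((d * M ^ 2 + a) ^ (-s)))
    (fun x => by
      have := ofReal_superharmonic (by omega : 0 < d) (f := fun x => potential d a (x - c))
        (fun x => potential_nonneg ha _) le_rfl (x := x) (by
          have := hsup (x - c)
          simpa only [mul_zero, zero_add, sub_add_eq_add_sub, sub_right_comm x _ c] using this)
      simpa using this)
    (fun x hx => ENNReal.ofReal_le_ofReal (le_potential hd ha (by simpa using hx))) z
  have hpot : potential d a (z - c) ≤ 1 / 4 * (d * M ^ 2 + a) ^ (-s) := by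
    refine (potential_le hd ha hR (j := j) (by simpa using hj)).trans ?_
    have h1 : R ^ (-((d : ℝ) - 2)) = (R ^ 2) ^ (-s) := by
      rw [← Real.rpow_natCast, ← Real.rpow_mul hR.le]
      congr 1
      push_cast
      rw [hs]
      ring
    have h2 : (16 : ℝ) ^ (-s) ≤ 1 / 4 := by
      rw [show (16 : ℝ) = 4 ^ (2 : ℝ) by norm_num, ← Real.rpow_mul (by norm_num)]
      refine (Real.rpow_le_rpow_of_exponent_le (by norm_num)
        (show 2 * -s ≤ -1 by rw [hs]; linarith)).trans_eq ?_
      rw [Real.rpow_neg_one]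
      norm_num
    rw [h1]
    refine (Real.rpow_le_rpow_of_nonpos (by positivity) hRM (by rw [hs]; linarith)).trans ?_
    rw [Real.mul_rpow (by norm_num) hq0.le]
    exact mul_le_mul_of_nonneg_right h2 (Real.rpow_nonneg hq0.le _)
  have hle := hhit.trans (ENNReal.ofReal_le_ofReal hpot)
  rw [ENNReal.ofReal_mul (by norm_num)] at hle
  exact (ENNReal.mul_le_mul_iff_left (ENNReal.ofReal_pos.2 (Real.rpow_pos_of_pos hq0 _)).ne'
    ENNReal.ofReal_ne_top).1 hle

end Potential

lemma mem_twoBoxVF {d Ln : ℕ} {i1 i2 : ℤ × ℤ} {x : Zd d} :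
    x ∈ twoBoxVF d Ln i1 i2 ↔ x ∈ twoBoxV d Ln i1 i2 := by
  simp only [twoBoxVF, twoBoxV, Finset.mem_union, Fintype.mem_piFinset, Finset.mem_Icc,
    Set.mem_union]
  refine or_congr (forall_congr' fun j => ?_) (forall_congr' fun j => ?_) <;>
  · rw [abs_le]
    constructor <;> rintro ⟨h1, h2⟩ <;> constructor <;> linarith

lemma rpow_le_ellOf (L : ℕ) : (L : ℝ) ^ ((1 : ℝ) / 100) ≤ ellOf L := by
  have h1 := (Nat.lt_floor_add_one ((L : ℝ) ^ ((1 : ℝ) / 100))).le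
  refine h1.trans ?_
  rw [ellOf]
  push_cast
  have : (0 : ℝ) ≤ ⌊(L : ℝ) ^ ((1 : ℝ) / 100)⌋₊ := Nat.cast_nonneg _
  linarith

lemma le_Lseq (L0 n : ℕ) : L0 ≤ Lseq L0 n := by
  induction n with
  | zero => exact le_rfl
  | succ n ih => exact ih.trans (Nat.le_mul_of_pos_left _ (Nat.succ_pos _))

lemma le_ellOf_Lseq {T : ℝ} (hT : 0 ≤ T) {L0 : ℕ} (h : T ^ 100 ≤ (L0 : ℝ)) (n : ℕ) :
    T ≤ ellOf (Lseq L0 n) := by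
  refine le_trans ?_ (rpow_le_ellOf _)
  have h1 : T ^ 100 ≤ (Lseq L0 n : ℝ) := h.trans (by exact_mod_cast le_Lseq L0 n)
  have h2 := Real.rpow_le_rpow (by positivity) h1 (show (0 : ℝ) ≤ 1 / 100 by norm_num)
  rwa [← Real.rpow_natCast, ← Real.rpow_mul hT, show ((100 : ℕ) : ℝ) * (1 / 100) = 1 by norm_num,
    Real.rpow_one] at h2

/-- The entrance law in the union of two boxes, from outside a neighbourhood at distance much
larger than the size of the boxes, is bounded by the equilibrium measure times the decay of the
Green function. -/
lemma IsSRW.tsum_entersAt_twoBoxV_le {d : ℕ} {P : Zd d → Measure (ℕ → Zd d)} (hP : IsSRW d P)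
    (hd : 3 ≤ d) {a : ℝ} (ha : 0 < a)
    (hsup : ∀ x : Zd d, ∑ i, (potential d a (x + Pi.single i 1) +
      potential d a (x - Pi.single i 1)) ≤ 2 * d * potential d a x)
    {Ln L1 : ℕ} (hL1 : 40 ≤ L1)
    (hL : 6400 * (d * (3 * Ln : ℝ) ^ 2 + a) ≤ (L1 : ℝ) ^ 2) (i1 i2 : ℤ × ℤ) {v y : Zd d}
    (hv : v ∈ twoBoxV d Ln i1 i2) (hy : y ∉ nbhdU d L1 (twoBoxV d Ln i1 i2)) :
    ∑' m, P y (entersAt (twoBoxV d Ln i1 i2) m v) ≤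
      ENNReal.ofReal (2 * (a ^ (-(((d : ℝ) - 2) / 2)) - (1 + a) ^ (-(((d : ℝ) - 2) / 2)))⁻¹ *
        40 ^ ((d : ℝ) - 2) * (L1 : ℝ) ^ (-((d : ℝ) - 2))) *
        P v {ω | ∀ n, 1 ≤ n → ω n ∉ twoBoxV d Ln i1 i2} := by
  have := hP.1
  set V := twoBoxV d Ln i1 i2 with hV
  set κ := a ^ (-(((d : ℝ) - 2) / 2)) - (1 + a) ^ (-(((d : ℝ) - 2) / 2))
  have hL1' : (40 : ℝ) ≤ L1 := by exact_mod_cast hL1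
  set U' : Set (Zd d) := {z | ∃ v ∈ V, ∀ j, 20 * |z j - v j| ≤ (L1 : ℤ)} with hU'
  have hvU : v ∈ U' := ⟨v, hv, fun j => by simp⟩
  have hyU : y ∉ U' := by
    rintro ⟨u, hu, h⟩
    refine hy ⟨u, hu, fun j => ?_⟩
    have := h j
    have := abs_nonneg (y j - u j)
    omega
  have hG : ∀ z ∈ bdry U', ∑' k, P z {ω | ω k = y} ≤
      ENNReal.ofReal (κ⁻¹ * ((L1 : ℝ) / 40) ^ (-((d : ℝ) - 2))) := by
    rintro z ⟨-, u, ⟨v0, hv0, hu⟩, hzu⟩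
    have hex : ∃ j, (L1 : ℤ) < 10 * |y j - v0 j| := by
      by_contra! hcon
      exact hy ⟨v0, hv0, hcon⟩
    obtain ⟨j, hj⟩ := hex
    have hzu' : |z j - u j| ≤ 1 := by
      have hsum : ∑ i, |z i - u i| = 1 := hzu
      rw [← hsum]
      exact Finset.single_le_sum (f := fun i => |z i - u i|) (fun _ _ => abs_nonneg _)
        (Finset.mem_univ j)
    have hfar : (L1 : ℤ) ≤ 40 * |z j - y j| := by
      have h1 := hu j
      have h2 : |y j - v0 j| ≤ |z j - y j| + |z j - u j| + |u j - v0 j| := by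
        rw [show y j - v0 j = -(z j - y j) + (z j - u j) + (u j - v0 j) by ring]
        refine (abs_add_three _ _ _).trans_eq ?_
        rw [abs_neg]
      omega
    refine hP.green_le hd ha hsup (by positivity) (j := j) ?_
    rw [div_le_iff₀ (by norm_num), mul_comm]
    exact_mod_cast hfar
  have hbox : ∀ i : ℤ × ℤ, (fun j => 2 * (Ln : ℤ) * embPlane d i j) ∈ V → ∀ z ∉ U',
      P z {ω | ∃ m, ω m ∈ {x : Zd d | ∀ j, |x j - 2 * (Ln : ℤ) * embPlane d i j| ≤ 3 * (Ln : ℤ)}} ≤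
        ENNReal.ofReal (1 / 4) := by
    intro i hi z hz
    have hex : ∃ j, (L1 : ℤ) < 20 * |z j - 2 * (Ln : ℤ) * embPlane d i j| := by
      by_contra! hcon
      exact hz ⟨_, hi, hcon⟩
    obtain ⟨j, hj⟩ := hex
    have hhit := hP.hit_box_le hd ha hsup (c := fun j => 2 * (Ln : ℤ) * embPlane d i j) (z := z)
      (R := L1 / 20) (M := 3 * Ln) (by positivity) (by rw [div_pow]; linarith) (j := j) (by
        rw [div_le_iff₀ (by norm_num), mul_comm]
        exact_mod_cast hj.le)
    refine le_trans (measure_mono ?_) hhit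
    rintro ω ⟨m, hm⟩
    exact ⟨m, fun j => by exact_mod_cast hm j⟩
  have hδ : ∀ z ∈ bdry U', ENNReal.ofReal (1 / 2) ≤ P z {ω | ∀ k, 0 ≤ k → ω k ∉ V} := by
    intro z hz
    have h1 := hbox i1 (Or.inl fun j => by simp) z hz.1
    have h2 := hbox i2 (Or.inr fun j => by simp) z hz.1
    have hcompl : P z {ω | ∀ k, 0 ≤ k → ω k ∉ V}ᶜ ≤ ENNReal.ofReal (1 / 2) := by
      rw [show (1 / 2 : ℝ) = 1 / 4 + 1 / 4 by norm_num,
        ENNReal.ofReal_add (by norm_num) (by norm_num)]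
      refine le_trans (measure_mono ?_) ((measure_union_le _ _).trans (add_le_add h1 h2))
      intro ω hω
      have hω' : ∃ k, ω k ∈ V := by
        by_contra! hcon
        exact hω fun k _ => hcon k
      obtain ⟨k, hk | hk⟩ := hω'
      · exact Or.inl ⟨k, hk⟩
      · exact Or.inr ⟨k, hk⟩
    have htot := prob_add_prob_compl (μ := P z) (measurableSet_avoid V 0)
    have hone : (1 : ENNReal) = ENNReal.ofReal (1 / 2) + ENNReal.ofReal (1 / 2) := by
      rw [← ENNReal.ofReal_add (by norm_num) (by norm_num)]
      norm_num
    rw [hone] at htot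
    by_contra! hlt
    exact absurd htot (ENNReal.add_lt_add_of_lt_of_le (ne_top_of_le_ne_top ENNReal.ofReal_ne_top
      hcompl) hlt hcompl).ne
  have hmain := hP.tsum_entersAt_mul_le (V := V) hvU hyU hG hδ
  have htwo : ENNReal.ofReal (1 / 2) * ENNReal.ofReal 2 = 1 := by
    rw [← ENNReal.ofReal_mul (by norm_num)]
    norm_num
  calc ∑' m, P y (entersAt V m v)
      = (∑' m, P y (entersAt V m v)) * ENNReal.ofReal (1 / 2) * ENNReal.ofReal 2 := by
        rw [mul_assoc, htwo, mul_one]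
    _ ≤ ENNReal.ofReal (κ⁻¹ * ((L1 : ℝ) / 40) ^ (-((d : ℝ) - 2))) *
        P v {ω | ∀ n, 1 ≤ n → ω n ∉ V} * ENNReal.ofReal 2 := mul_le_mul_left hmain _
    _ = ENNReal.ofReal 2 * ENNReal.ofReal (κ⁻¹ * ((L1 : ℝ) / 40) ^ (-((d : ℝ) - 2))) *
        P v {ω | ∀ n, 1 ≤ n → ω n ∉ V} := by ring
    _ = _ := by
      rw [← ENNReal.ofReal_mul zero_le_two, Real.div_rpow (by positivity) (by norm_num),
        Real.rpow_neg (by norm_num : (0 : ℝ) ≤ 40), div_inv_eq_mul]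
      congr 2
      ring

end RI

open RI MeasureTheory Filter

/-- **The key intensity bound** ((2.42)).
With `V` the union of the two boxes and `U` its neighbourhood as in Proposition 2.1, for
`ℓ ≥ 2` and paths `w₁, …, w_ℓ ∈ 𝒯`:
`Σ_x e_V(x) P_x[R_ℓ < ∞, (X_{R_k+·})_{·≤D_k-R_k} = w_k, 1 ≤ k ≤ ℓ]
  ≤ (c L_{n+1}^{-(d-2)})^{ℓ-1} Π_k Σ_x e_V(x) P_x[(X_·)_{·≤T_U} = w_k]`. -/
theorem intensity_bound (d : ℕ) (hd : 3 ≤ d) :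
    ∃ c c' : ℝ, 0 < c ∧ 0 < c' ∧
      ∀ L0 : ℕ, c' ≤ (L0 : ℝ) → ∀ n : ℕ, ∀ i1 i2 : ℤ × ℤ,
        max |i1.1| |i1.2| = ((ellOf (Lseq L0 n) : ℤ) - 1) / 2 →
        max |i2.1| |i2.2| = (ellOf (Lseq L0 n) : ℤ) →
        ∀ (P : Zd d → Measure (ℕ → Zd d)), IsSRW d P →
          ∀ l : ℕ, 2 ≤ l → ∀ (Nw : Fin l → ℕ) (w : Fin l → ℕ → Zd d),
            (∀ k : Fin l, inT (twoBoxV d (Lseq L0 n) i1 i2)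
                (nbhdU d (Lseq L0 (n + 1)) (twoBoxV d (Lseq L0 n) i1 i2)) (Nw k) (w k)) →
            (∑ x ∈ twoBoxVF d (Lseq L0 n) i1 i2,
                eqm P (twoBoxV d (Lseq L0 n) i1 i2) x *
                  (P x {ω | ∀ k : Fin l, ∃ r : ℕ,
                      (RD (twoBoxV d (Lseq L0 n) i1 i2)
                        (nbhdU d (Lseq L0 (n + 1)) (twoBoxV d (Lseq L0 n) i1 i2))
                        ω ((k : ℕ) + 1)).1 = (r : ℕ∞) ∧
                      (RD (twoBoxV d (Lseq L0 n) i1 i2)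
                        (nbhdU d (Lseq L0 (n + 1)) (twoBoxV d (Lseq L0 n) i1 i2))
                        ω ((k : ℕ) + 1)).2 = ((r + Nw k : ℕ) : ℕ∞) ∧
                      ∀ j ≤ Nw k, ω (r + j) = w k j}).toReal) ≤
              (c * (Lseq L0 (n + 1) : ℝ) ^ (-((d : ℝ) - 2))) ^ (l - 1) *
                ∏ k : Fin l,
                  (∑ x ∈ twoBoxVF d (Lseq L0 n) i1 i2,
                    eqm P (twoBoxV d (Lseq L0 n) i1 i2) x *
                      (P x {ω |
                        (∀ j < Nw k,
                          ω j ∈ nbhdU d (Lseq L0 (n + 1)) (twoBoxV d (Lseq L0 n) i1 i2)) ∧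
                        ω (Nw k) ∉ nbhdU d (Lseq L0 (n + 1)) (twoBoxV d (Lseq L0 n) i1 i2) ∧
                        ∀ j ≤ Nw k, ω j = w k j}).toReal) := by
  obtain ⟨a, ha, hsup⟩ := exists_potential_superharmonic hd
  have hd' : (3 : ℝ) ≤ d := by exact_mod_cast hd
  have hκ : 0 < a ^ (-(((d : ℝ) - 2) / 2)) - (1 + a) ^ (-(((d : ℝ) - 2) / 2)) :=
    sub_pos.2 (Real.rpow_lt_rpow_of_neg ha (by linarith) (by linarith))
  have hT : 1 ≤ 6400 * (9 * d + a) := by linarith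
  have hc : 0 < 2 * (a ^ (-(((d : ℝ) - 2) / 2)) - (1 + a) ^ (-(((d : ℝ) - 2) / 2)))⁻¹ *
      40 ^ ((d : ℝ) - 2) := by positivity
  refine ⟨_, (6400 * (9 * d + a)) ^ 100, hc, by positivity, ?_⟩
  intro L0 hL0 n i1 i2 _ _ P hP l hl Nw w hw
  have hell := le_ellOf_Lseq (by linarith) hL0 n
  have hLn : (1 : ℝ) ≤ Lseq L0 n := by
    have h1 : (L0 : ℝ) ≤ Lseq L0 n := by exact_mod_cast le_Lseq L0 n
    exact (one_le_pow₀ hT).trans (hL0.trans h1)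
  have hL1 : (Lseq L0 (n + 1) : ℝ) = ellOf (Lseq L0 n) * Lseq L0 n := by
    rw [Lseq]
    push_cast
    rfl
  refine hP.sum_eqm_mul_le (fun x => mem_twoBoxVF) (by positivity) (fun v hv y hy =>
    hP.tsum_entersAt_twoBoxV_le hd ha hsup ?_ ?_ i1 i2 hv hy) (by omega) Nw w hw
  · have : (40 : ℝ) ≤ Lseq L0 (n + 1) := by
      rw [hL1]
      nlinarith
    exact_mod_cast this
  · rw [hL1]
    have h1 : (1 : ℝ) ≤ (Lseq L0 n : ℝ) ^ 2 := one_le_pow₀ hLn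
    have h2 : 6400 * (9 * d + a) ≤ (ellOf (Lseq L0 n) : ℝ) ^ 2 := by nlinarith
    calc 6400 * (d * (3 * (Lseq L0 n : ℝ)) ^ 2 + a)
        ≤ 6400 * (9 * d + a) * (Lseq L0 n : ℝ) ^ 2 := by nlinarith
      _ ≤ _ := by rw [mul_pow]; gcongr
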